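/- arXiv:2006.11531 — 2 statements merged into one kernel-verified Lean document; each statement's English description precedes it below -/
import Mathlib

section
/- Let T > 0, μ ∈ (1/2,1], β ∈ (0,2] and s ≥ 0. Every u ∈ T_μ((0,T); X_β^s) ∩ L²_μ((0,T); X_β^{s+1}) has a representative which is continuous from (0,T] to X_β^{s+1/2}; moreover, for every δ ∈ (0,T) there is a constant C = C(δ,T,μ,β,s) > 0, independent of u, such that sup_{t∈[δ,T]} ‖u(t)‖_{X_β^{s+1/2}} ≤ C (‖u‖_{T_μ((0,T);X_β^s)} + ‖u‖_{L²_μ((0,T);X_β^{s+1})}). -/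
open MeasureTheory Set Filter
open scoped ENNReal

noncomputable section

/-- `ℝⁿ` with the Euclidean norm. -/
abbrev En (n : ℕ) : Type := EuclideanSpace ℝ (Fin n)

/-- `ω_β(k,ξ) = 1 + ‖k‖^{β/(β+1)} + ‖ξ‖^β`. -/
def omegaB (n : ℕ) (β : ℝ) (k ξ : En n) : ℝ := 1 + ‖k‖ ^ (β / (β + 1)) + ‖ξ‖ ^ β

/-- Squared norm of the anisotropic Sobolev space `X_β^s`, on the Fourier side:
`w` is the Fourier transform `û(k,ξ)`. -/
def Xnorm (n : ℕ) (β s : ℝ) (w : En n → En n → ℂ) : ℝ≥0∞ :=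
  ∫⁻ (k : En n), ∫⁻ (ξ : En n), ENNReal.ofReal (omegaB n β k ξ ^ (2 * s) * ‖w k ξ‖ ^ 2)

/-- Squared norm of `L²_μ((0,T); X_β^s)`, on the Fourier side. -/
def L2X (n : ℕ) (β s T μ : ℝ) (U : ℝ → En n → En n → ℂ) : ℝ≥0∞ :=
  ∫⁻ t in Ioo 0 T, ENNReal.ofReal (t ^ (2 - 2*μ)) * Xnorm n β s (U t)

/-- The Fourier side of the kinetic transport derivative: `Ĥ = ∂_t Û − k·∇_ξ Û` in the
sense of distributions on `(0,T) × ℝ^{2n}` (a point of `ℝ^{2n}` is `q = (k,ξ)`); this is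
the Fourier transform of `h = ∂_t u + v·∇ₓ u`. -/
def IsFTransportDeriv (n : ℕ) (T : ℝ) (U H : ℝ → En n → En n → ℂ) : Prop :=
  ∀ φ : ℝ × (En n × En n) → ℝ, ContDiff ℝ ((⊤ : ℕ∞) : WithTop ℕ∞) φ → HasCompactSupport φ →
    (∀ p : ℝ × (En n × En n), p.1 ∉ Ioo 0 T → φ p = 0) →
    -(∫ t in Ioo 0 T, ∫ q : En n × En n,
        U t q.1 q.2 * (fderiv ℝ φ (t, q) ((1 : ℝ), ((0 : En n), -q.1)) : ℂ))
      = ∫ t in Ioo 0 T, ∫ q : En n × En n, H t q.1 q.2 * (φ (t, q) : ℂ)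

/-- Joint measurability of `U : ℝ → En n → En n → ℂ`. -/
def MeasU (n : ℕ) (U : ℝ → En n → En n → ℂ) : Prop :=
  Measurable (fun p : ℝ × En n × En n => U p.1 p.2.1 p.2.2)

section Transport

open scoped ContDiff Topology

variable {E : Type*} [NormedAddCommGroup E]

theorem contDiff_primitive_fst [NormedSpace ℝ E] {φ : ℝ × E → ℝ} (hφ : ContDiff ℝ ∞ φ)
    (hc : HasCompactSupport φ) (h0 : ∀ p : ℝ × E, p.1 ≤ 0 → φ p = 0) :
    ContDiff ℝ ∞ (fun p : ℝ × E => ∫ r in (0 : ℝ)..p.1, φ (r, p.2)) := by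
  have hK : IsCompact (Prod.fst '' tsupport φ) := hc.isCompact.image continuous_fst
  have key := contDiffOn_convolution_right_with_param (𝕜 := ℝ) (μ := (volume : Measure ℝ))
    (f := indicator (Ioi (0 : ℝ)) (fun _ => (1 : ℝ))) (n := ⊤) (ContinuousLinearMap.mul ℝ ℝ)
    (g := fun (q : E) (t : ℝ) => φ (t, q)) (s := univ) (k := Prod.fst '' tsupport φ)
    isOpen_univ hK
    (by
      intro q t _ ht
      by_contra hne
      exact ht ⟨(t, q), subset_tsupport _ hne, rfl⟩)
    ((locallyIntegrable_const (1 : ℝ)).indicator measurableSet_Ioi)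
    (by
      have : ContDiff ℝ ∞ (fun p : E × ℝ => φ (p.2, p.1)) := by fun_prop
      exact this.contDiffOn)
  rw [univ_prod_univ, contDiffOn_univ] at key
  have := key.comp (contDiff_snd.prodMk contDiff_fst : ContDiff ℝ ∞ fun p : ℝ × E => (p.2, p.1))
  convert this using 1
  ext ⟨x, q⟩
  symm
  simp only [Function.comp, convolution_def, ContinuousLinearMap.mul_apply']
  have e1 : (fun t => indicator (Ioi (0 : ℝ)) (fun _ => (1 : ℝ)) t * φ (x - t, q))
      = indicator (Ioi (0 : ℝ)) (fun t => φ (x - t, q)) := by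
    ext t; by_cases ht : t ∈ Ioi (0 : ℝ) <;> simp [ht]
  rw [e1, integral_indicator measurableSet_Ioi]
  rcases le_total 0 x with hx | hx
  · have e2 : ∫ t in (0 : ℝ)..x, φ (x - t, q) = ∫ t in (0 : ℝ)..x, φ (t, q) := by
      have := intervalIntegral.integral_comp_sub_left (a := 0) (b := x) (fun t => φ (t, q)) x
      simpa using this
    rw [← e2, intervalIntegral.integral_of_le hx]
    refine setIntegral_eq_of_subset_of_forall_sdiff_eq_zero measurableSet_Ioi
      (Ioc_subset_Ioi_self : Ioc 0 x ⊆ Ioi 0) ?_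
    intro t ht
    refine h0 _ ?_
    have h1 : 0 < t := ht.1
    have : ¬ t ≤ x := fun h => ht.2 ⟨h1, h⟩
    simp only; linarith
  · rw [intervalIntegral.integral_zero_ae, setIntegral_eq_zero_of_forall_eq_zero]
    · intro t ht; exact h0 _ (by have : 0 < t := ht; simp only; linarith)
    · refine Eventually.of_forall fun t ht => h0 _ ?_
      rw [uIoc_of_ge hx] at ht; exact ht.2

theorem hasDerivAt_primitive_fst {φ : ℝ × E → ℝ} (hφ : Continuous φ) (t : ℝ) (q : E) :
    HasDerivAt (fun x => ∫ r in (0 : ℝ)..x, φ (r, q)) (φ (t, q)) t := by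
  have hc : Continuous fun r => φ (r, q) := by fun_prop
  exact hc.integral_hasStrictDerivAt 0 t |>.hasDerivAt

/-- A smooth transition in time from `0` to `1` across `[0, T]`. -/
def timeCutoff (T t : ℝ) : ℝ := Real.smoothTransition (t / T)

theorem contDiff_timeCutoff (T : ℝ) : ContDiff ℝ ∞ (timeCutoff T) :=
  Real.smoothTransition.contDiff.comp (contDiff_id.div_const T)

theorem timeCutoff_of_nonpos {T t : ℝ} (hT : 0 < T) (ht : t ≤ 0) : timeCutoff T t = 0 :=
  Real.smoothTransition.zero_of_nonpos (div_nonpos_of_nonpos_of_nonneg ht hT.le)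

theorem timeCutoff_of_le {T t : ℝ} (hT : 0 < T) (ht : T ≤ t) : timeCutoff T t = 1 :=
  Real.smoothTransition.one_of_one_le ((one_le_div hT).2 ht)

theorem continuous_deriv_timeCutoff (T : ℝ) : Continuous (deriv (timeCutoff T)) :=
  (contDiff_timeCutoff T).continuous_deriv (by simp)

theorem exists_bound_deriv_timeCutoff {T : ℝ} (hT : 0 < T) :
    ∃ C : ℝ, ∀ t, ‖deriv (timeCutoff T) t‖ ≤ C := by
  have hs : HasCompactSupport (deriv (timeCutoff T)) := by
    refine HasCompactSupport.intro (isCompact_Icc : IsCompact (Icc 0 T)) fun t ht => ?_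
    rw [mem_Icc, not_and_or, not_le, not_le] at ht
    rcases ht with ht | ht
    · have : timeCutoff T =ᶠ[𝓝 t] fun _ => 0 := by
        filter_upwards [gt_mem_nhds ht] with x hx using timeCutoff_of_nonpos hT hx.le
      rw [this.deriv_eq]; simp
    · have : timeCutoff T =ᶠ[𝓝 t] fun _ => 1 := by
        filter_upwards [lt_mem_nhds ht] with x hx using timeCutoff_of_le hT hx.le
      rw [this.deriv_eq]; simp
  exact hs.exists_bound_of_continuous (continuous_deriv_timeCutoff T)

/-- The test function whose time derivative is `φ` up to a multiple of the derivative of the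
cutoff. -/
def testPrimitive (T : ℝ) (φ : ℝ × E → ℝ) (p : ℝ × E) : ℝ :=
  (∫ r in (0 : ℝ)..p.1, φ (r, p.2)) - timeCutoff T p.1 * ∫ r in (0 : ℝ)..T, φ (r, p.2)

section TestPrimitive

variable {T : ℝ} {φ : ℝ × E → ℝ}

theorem testPrimitive_eq_zero (hT : 0 < T) (hc : Continuous φ)
    (h0 : ∀ p : ℝ × E, p.1 ∉ Ioo 0 T → φ p = 0)
    (p : ℝ × E) (hp : p.1 ∉ Ioo 0 T) : testPrimitive T φ p = 0 := by
  rw [mem_Ioo, not_and_or, not_lt, not_lt] at hp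
  rcases hp with hp | hp
  · rw [testPrimitive, timeCutoff_of_nonpos hT hp, intervalIntegral.integral_zero_ae]
    · simp
    · refine Eventually.of_forall fun t ht => h0 _ ?_
      rw [uIoc_of_ge hp] at ht
      exact fun h => absurd h.1 (not_lt.2 ht.2)
  · have hi : ∀ a b : ℝ, IntervalIntegrable (fun r => φ (r, p.2)) volume a b := fun a b =>
      (by fun_prop : Continuous fun r => φ (r, p.2)).intervalIntegrable a b
    rw [testPrimitive, timeCutoff_of_le hT hp,
      ← intervalIntegral.integral_add_adjacent_intervals (hi 0 T) (hi T p.1)]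
    have : ∫ r in T..p.1, φ (r, p.2) = 0 := by
      refine intervalIntegral.integral_zero_ae (Eventually.of_forall fun t ht => h0 _ ?_)
      rw [uIoc_of_le hp] at ht
      exact fun h => absurd h.2 (not_lt.2 ht.1.le)
    rw [this]; ring

theorem contDiff_testPrimitive [NormedSpace ℝ E] (hφ : ContDiff ℝ ∞ φ) (hc : HasCompactSupport φ)
    (h0 : ∀ p : ℝ × E, p.1 ∉ Ioo 0 T → φ p = 0) : ContDiff ℝ ∞ (testPrimitive T φ) := by
  have h := contDiff_primitive_fst hφ hc
    fun p hp => h0 p fun h => absurd h.1 (not_lt.2 hp)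
  have h2 : ContDiff ℝ ∞ fun p : ℝ × E => ∫ r in (0 : ℝ)..T, φ (r, p.2) :=
    h.comp (contDiff_const.prodMk contDiff_snd : ContDiff ℝ ∞ fun p : ℝ × E => (T, p.2))
  exact h.sub (((contDiff_timeCutoff T).comp contDiff_fst).mul h2)

theorem hasCompactSupport_testPrimitive (hT : 0 < T) (hφ : Continuous φ)
    (hc : HasCompactSupport φ)
    (h0 : ∀ p : ℝ × E, p.1 ∉ Ioo 0 T → φ p = 0) : HasCompactSupport (testPrimitive T φ) := by
  refine HasCompactSupport.intro
    ((isCompact_Icc : IsCompact (Icc 0 T)).prod (hc.isCompact.image continuous_snd)) fun p hp => ?_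
  by_cases h1 : p.1 ∈ Ioo 0 T
  · have h2 : p.2 ∉ Prod.snd '' tsupport φ := fun h => hp ⟨Ioo_subset_Icc_self h1, h⟩
    have h3 : ∀ r, φ (r, p.2) = 0 := fun r => by
      by_contra hne
      exact h2 ⟨(r, p.2), subset_tsupport _ hne, rfl⟩
    simp [testPrimitive, h3]
  · exact testPrimitive_eq_zero hT hφ h0 p h1

theorem hasDerivAt_testPrimitive (hφ : Continuous φ) (t : ℝ) (q : E) :
    HasDerivAt (fun x => testPrimitive T φ (x, q))
      (φ (t, q) - deriv (timeCutoff T) t * ∫ r in (0 : ℝ)..T, φ (r, q)) t :=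
  (hasDerivAt_primitive_fst hφ t q).sub <| HasDerivAt.mul_const
    (((contDiff_timeCutoff T).differentiable (by simp)) t).hasDerivAt
    (∫ r in (0 : ℝ)..T, φ (r, q))

theorem fderiv_testPrimitive [NormedSpace ℝ E] (hφ : ContDiff ℝ ∞ φ) (hc : HasCompactSupport φ)
    (h0 : ∀ p : ℝ × E, p.1 ∉ Ioo 0 T → φ p = 0) (t : ℝ) (q : E) :
    fderiv ℝ (testPrimitive T φ) (t, q) ((1 : ℝ), (0 : E))
      = φ (t, q) - deriv (timeCutoff T) t * ∫ r in (0 : ℝ)..T, φ (r, q) := by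
  have h1 : HasFDerivAt (testPrimitive T φ) (fderiv ℝ (testPrimitive T φ) (t, q)) (t, q) :=
    ((contDiff_testPrimitive hφ hc h0).differentiable (by simp) (t, q)).hasFDerivAt
  have h2 : HasDerivAt (fun x : ℝ => (x, q)) ((1 : ℝ), (0 : E)) t :=
    (hasDerivAt_id t).prodMk (hasDerivAt_const t q)
  have h3 : HasDerivAt (fun x => testPrimitive T φ (x, q))
      (fderiv ℝ (testPrimitive T φ) (t, q) ((1 : ℝ), (0 : E))) t :=
    HasFDerivAt.comp_hasDerivAt (f := fun x : ℝ => (x, q)) t h1 h2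
  exact h3.unique (hasDerivAt_testPrimitive hφ.continuous t q)

end TestPrimitive

/-- The primitive in time of `G` that agrees with `W` when `∂ₜ W = G` on `(0, T)`, for `W` and
`G` vanishing outside `(0, T)`. -/
def timePrimitive (T : ℝ) (W G : ℝ → ℂ) (r : ℝ) : ℂ :=
  ∫ t, (deriv (timeCutoff T) t • W t + (timeCutoff T t - if r < t then 1 else 0) • G t)

section TimePrimitive

variable {T : ℝ} {W G : ℝ → ℂ}

theorem abs_timeCutoff_sub_le (T r t : ℝ) :
    ‖timeCutoff T t - if r < t then (1 : ℝ) else 0‖ ≤ 1 := by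
  have h1 := Real.smoothTransition.nonneg (t / T)
  have h2 := Real.smoothTransition.le_one (t / T)
  rw [Real.norm_eq_abs, abs_le, timeCutoff]
  split_ifs <;> constructor <;> linarith

theorem measurable_timeCutoff_sub (T : ℝ) :
    Measurable fun z : ℝ × ℝ => timeCutoff T z.2 - if z.1 < z.2 then (1 : ℝ) else 0 := by
  refine ((contDiff_timeCutoff T).continuous.measurable.comp measurable_snd).sub ?_
  exact Measurable.ite (measurableSet_lt measurable_fst measurable_snd) measurable_const
    measurable_const

theorem integrable_deriv_smul (hT : 0 < T) (hW : Integrable W) :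
    Integrable fun t => deriv (timeCutoff T) t • W t := by
  obtain ⟨C, hC⟩ := exists_bound_deriv_timeCutoff hT
  exact hW.bdd_smul C (continuous_deriv_timeCutoff T).aestronglyMeasurable
    (Eventually.of_forall hC)

theorem integrable_cutoff_smul (T : ℝ) (hG : Integrable G) (r : ℝ) :
    Integrable fun t => (timeCutoff T t - if r < t then (1 : ℝ) else 0) • G t :=
  hG.bdd_smul 1
    ((measurable_timeCutoff_sub T).comp (measurable_const.prodMk measurable_id)).aestronglyMeasurable
    (Eventually.of_forall (abs_timeCutoff_sub_le T r))

theorem integrable_timePrimitive_integrand (hT : 0 < T) (hW : Integrable W) (hG : Integrable G)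
    (r : ℝ) : Integrable fun t => deriv (timeCutoff T) t • W t
      + (timeCutoff T t - if r < t then (1 : ℝ) else 0) • G t :=
  (integrable_deriv_smul hT hW).add (integrable_cutoff_smul T hG r)

theorem timePrimitive_sub (hT : 0 < T) (hW : Integrable W) (hG : Integrable G) {s r : ℝ}
    (hsr : s ≤ r) : timePrimitive T W G r - timePrimitive T W G s = ∫ t in Ioc s r, G t := by
  rw [timePrimitive, timePrimitive, ← integral_sub
    (integrable_timePrimitive_integrand hT hW hG r)
    (integrable_timePrimitive_integrand hT hW hG s),
    ← integral_indicator measurableSet_Ioc]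
  congr 1
  ext t
  by_cases h1 : s < t <;> by_cases h2 : r < t
  · simp [indicator, h1, h2]
  · simp only [indicator, h1, h2, not_lt.1 h2, mem_Ioc, if_true, if_false, and_self, sub_smul,
      one_smul, zero_smul]; ring
  · exact absurd (hsr.trans_lt h2) h1
  · simp [indicator, h1, h2]

theorem continuous_timePrimitive (hT : 0 < T) (hW : Integrable W) (hG : Integrable G) :
    Continuous (timePrimitive T W G) := by
  have h : timePrimitive T W G = fun r => timePrimitive T W G 0 + ∫ t in (0 : ℝ)..r, G t := by
    ext r
    rcases le_total 0 r with hr | hr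
    · rw [intervalIntegral.integral_of_le hr, ← timePrimitive_sub hT hW hG hr]; ring
    · rw [intervalIntegral.integral_of_ge hr, ← timePrimitive_sub hT hW hG hr]; ring
  rw [h]
  exact continuous_const.add (intervalIntegral.continuous_primitive
    (fun a b => hG.intervalIntegrable) 0)

theorem enorm_timePrimitive_le (hT : 0 < T) :
    ∃ C : ℝ≥0∞, C ≠ ⊤ ∧ ∀ (W G : ℝ → ℂ) (r : ℝ), Measurable W → Measurable G →
      ‖timePrimitive T W G r‖ₑ ≤ C * (∫⁻ t, ‖W t‖ₑ) + ∫⁻ t, ‖G t‖ₑ := by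
  obtain ⟨C, hC⟩ := exists_bound_deriv_timeCutoff hT
  refine ⟨ENNReal.ofReal C, ENNReal.ofReal_ne_top, fun W G r hW hG => ?_⟩
  refine (enorm_integral_le_lintegral_enorm _).trans ?_
  rw [← lintegral_const_mul _ hW.enorm, ← lintegral_add_left (hW.enorm.const_mul _)]
  refine lintegral_mono fun t => (enorm_add_le _ _).trans (add_le_add ?_ ?_)
  · rw [enorm_smul]
    gcongr
    rw [← ofReal_norm]
    exact ENNReal.ofReal_le_ofReal (hC t)
  · rw [enorm_smul]
    refine mul_le_of_le_one_left' ?_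
    rw [← ofReal_norm, ← ENNReal.ofReal_one]
    exact ENNReal.ofReal_le_ofReal (abs_timeCutoff_sub_le T r t)

theorem integral_smul_sub_timePrimitive (hT : 0 < T) (hW : Integrable W) (hG : Integrable G)
    {f : ℝ → ℝ} (hf : Continuous f) (h0 : ∀ t, t ∉ Ioo 0 T → f t = 0) :
    ∫ r, f r • (W r - timePrimitive T W G r)
      = ∫ t, ((f t - deriv (timeCutoff T) t * ∫ r in (0 : ℝ)..T, f r) • W t
          + ((∫ r in (0 : ℝ)..t, f r) - timeCutoff T t * ∫ r in (0 : ℝ)..T, f r) • G t) := by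
  have hfc : HasCompactSupport f := HasCompactSupport.intro (isCompact_Icc : IsCompact (Icc 0 T))
    fun t ht => h0 t fun h => ht (Ioo_subset_Icc_self h)
  have hfi : Integrable f := hf.integrable_of_hasCompactSupport hfc
  obtain ⟨C, hC⟩ := hfc.exists_bound_of_continuous hf
  have hfW : Integrable fun r => f r • W r :=
    hW.bdd_smul C hf.aestronglyMeasurable (Eventually.of_forall hC)
  have hm : ∫ r in (0 : ℝ)..T, f r = ∫ r, f r := by
    rw [intervalIntegral.integral_of_le hT.le]
    exact setIntegral_eq_integral_of_forall_compl_eq_zero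
      fun t ht => h0 t fun h => ht (Ioo_subset_Ioc_self h)
  have hP : ∀ t, ∫ r in (0 : ℝ)..t, f r = ∫ r, f r * if r < t then 1 else 0 := by
    intro t
    have hneg : ∫ r in Iic (0 : ℝ), f r = 0 := setIntegral_eq_zero_of_forall_eq_zero
      fun r hr => h0 r fun h => absurd h.1 (not_lt.2 hr)
    rw [← intervalIntegral.integral_Iic_sub_Iic hfi.integrableOn hfi.integrableOn, hneg, sub_zero,
      integral_Iic_eq_integral_Iio, ← integral_indicator measurableSet_Iio]
    congr 1
    ext r
    by_cases h : r < t <;> simp [h]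
  have hker : Integrable (Function.uncurry fun r t : ℝ => f r •
      (deriv (timeCutoff T) t • W t + (timeCutoff T t - if r < t then (1 : ℝ) else 0) • G t))
      (volume.prod volume) := by
    have h1 := hfi.smul_prod (integrable_deriv_smul hT hW)
    have h2 := (hfi.smul_prod hG).bdd_smul 1
      (measurable_timeCutoff_sub T).aestronglyMeasurable
      (Eventually.of_forall fun z => abs_timeCutoff_sub_le T z.1 z.2)
    refine (h1.add h2).congr (Eventually.of_forall fun z => ?_)
    simp only [Function.uncurry, Pi.add_apply, Pi.smul_apply', smul_add]
    rw [smul_comm (f z.1) (timeCutoff T z.2 - _)]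
  have hkey : ∫ r, f r • timePrimitive T W G r = ∫ t, ∫ r, f r •
      (deriv (timeCutoff T) t • W t
        + (timeCutoff T t - if r < t then (1 : ℝ) else 0) • G t) := by
    rw [← integral_integral_swap hker]
    exact integral_congr_ae (Eventually.of_forall fun r => (integral_smul _ _).symm)
  have hfw : Integrable fun r => f r • timePrimitive T W G r :=
    ((hf.smul (continuous_timePrimitive hT hW hG)).integrable_of_hasCompactSupport hfc.smul_right)
  simp_rw [smul_sub]
  have hright := hker.integral_prod_right
  simp only [Function.uncurry] at hright
  rw [integral_sub hfW hfw, hkey, ← integral_sub hfW hright]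
  refine integral_congr_ae (Eventually.of_forall fun t => ?_)
  have hfκ : Integrable fun r => f r * if r < t then (1 : ℝ) else 0 := by
    refine hfi.mul_bdd (c := 1) ?_ (Eventually.of_forall fun r => ?_)
    · exact (Measurable.ite measurableSet_Iio measurable_const
        measurable_const).aestronglyMeasurable
    · split_ifs <;> simp
  have hfκ' := (hfi.mul_const (timeCutoff T t)).sub hfκ
  simp only [Pi.sub_def] at hfκ'
  have hinner : ∫ r, f r • (deriv (timeCutoff T) t • W t
        + (timeCutoff T t - if r < t then (1 : ℝ) else 0) • G t)
      = ((∫ r, f r) * deriv (timeCutoff T) t) • W t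
        + ((∫ r, f r) * timeCutoff T t - ∫ r, f r * if r < t then (1 : ℝ) else 0) • G t := by
    rw [← integral_mul_const, ← integral_mul_const, ← integral_sub (hfi.mul_const _) hfκ,
      ← integral_smul_const, ← integral_smul_const,
      ← integral_add ((hfi.mul_const _).smul_const _) (hfκ'.smul_const _)]
    refine integral_congr_ae (Eventually.of_forall fun r => ?_)
    simp only [smul_add, smul_smul, mul_sub]
  beta_reduce
  rw [hinner, hm, hP]
  module

end TimePrimitive

section Weak

variable [NormedSpace ℝ E] [FiniteDimensional ℝ E] [MeasurableSpace E]
  {ν : Measure E} [ν.IsAddHaarMeasure]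

theorem locallyIntegrable_of_lintegral_lintegral {Z : ℝ × E → ℂ}
    (hZ : AEStronglyMeasurable Z (volume.prod ν))
    (h : ∀ (I : Set ℝ) (K : Set E), IsCompact I → IsCompact K →
      ∫⁻ q in K, (∫⁻ t in I, ‖Z (t, q)‖ₑ) ∂ν ≠ ⊤) : LocallyIntegrable Z (volume.prod ν) := by
  refine locallyIntegrable_iff.2 fun A hA => ?_
  have hI := hA.image continuous_fst
  have hK := hA.image continuous_snd
  refine IntegrableOn.mono_set (t := (Prod.fst '' A) ×ˢ (Prod.snd '' A)) ?_
    fun p hp => ⟨⟨p, hp, rfl⟩, ⟨p, hp, rfl⟩⟩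
  refine ⟨hZ.restrict, ?_⟩
  have hZ' := hZ.restrict (s := (Prod.fst '' A) ×ˢ (Prod.snd '' A))
  rw [← Measure.prod_restrict] at hZ' ⊢
  rw [HasFiniteIntegral, lintegral_prod_symm _ hZ'.enorm]
  exact (h _ _ hI hK).lt_top

variable [BorelSpace E]

theorem ae_eq_timePrimitive {T : ℝ} (hT : 0 < T) {W G : ℝ × E → ℂ} (hWm : Measurable W)
    (hGm : Measurable G)
    (hWK : ∀ K : Set E, IsCompact K → ∫⁻ q in K, (∫⁻ t, ‖W (t, q)‖ₑ) ∂ν ≠ ⊤)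
    (hGK : ∀ K : Set E, IsCompact K → ∫⁻ q in K, (∫⁻ t, ‖G (t, q)‖ₑ) ∂ν ≠ ⊤)
    (hWi : ∀ᵐ q ∂ν, Integrable fun t => W (t, q)) (hGi : ∀ᵐ q ∂ν, Integrable fun t => G (t, q))
    (hweak : ∀ ψ : ℝ × E → ℝ, ContDiff ℝ ∞ ψ → HasCompactSupport ψ →
      (∀ p : ℝ × E, p.1 ∉ Ioo 0 T → ψ p = 0) →
      ∫ p, fderiv ℝ ψ p ((1 : ℝ), (0 : E)) • W p ∂(volume.prod ν)
        + ∫ p, ψ p • G p ∂(volume.prod ν) = 0)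
    (hPm : AEStronglyMeasurable (fun p : ℝ × E =>
      timePrimitive T (fun t => W (t, p.2)) (fun t => G (t, p.2)) p.1) (volume.prod ν)) :
    ∀ᵐ p ∂(volume.prod ν), p.1 ∈ Ioo 0 T →
      W p = timePrimitive T (fun t => W (t, p.2)) (fun t => G (t, p.2)) p.1 := by
  have hWl : LocallyIntegrable W (volume.prod ν) :=
    locallyIntegrable_of_lintegral_lintegral hWm.aestronglyMeasurable fun I K _ hK =>
      ne_top_of_le_ne_top (hWK K hK) (lintegral_mono fun q => setLIntegral_le_lintegral _ _)
  have hGl : LocallyIntegrable G (volume.prod ν) :=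
    locallyIntegrable_of_lintegral_lintegral hGm.aestronglyMeasurable fun I K _ hK =>
      ne_top_of_le_ne_top (hGK K hK) (lintegral_mono fun q => setLIntegral_le_lintegral _ _)
  have hPl : LocallyIntegrable (fun p : ℝ × E =>
      timePrimitive T (fun t => W (t, p.2)) (fun t => G (t, p.2)) p.1) (volume.prod ν) := by
    refine locallyIntegrable_of_lintegral_lintegral hPm fun I K hI hK => ?_
    obtain ⟨C, hC, hbd⟩ := enorm_timePrimitive_le hT
    have hW' : Measurable fun q => ∫⁻ t, ‖W (t, q)‖ₑ := hWm.enorm.lintegral_prod_left'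
    refine ne_top_of_le_ne_top (b := volume I * (C * (∫⁻ q in K, (∫⁻ t, ‖W (t, q)‖ₑ) ∂ν)
      + ∫⁻ q in K, (∫⁻ t, ‖G (t, q)‖ₑ) ∂ν)) (ENNReal.mul_ne_top hI.measure_ne_top
        (ENNReal.add_ne_top.2 ⟨ENNReal.mul_ne_top hC (hWK K hK), hGK K hK⟩)) ?_
    rw [← lintegral_const_mul' _ _ hC, ← lintegral_add_left (hW'.const_mul _),
      ← lintegral_const_mul' _ _ hI.measure_ne_top]
    refine lintegral_mono fun q => ?_
    rw [mul_comm, ← setLIntegral_const]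
    exact lintegral_mono fun t => hbd _ _ t (hWm.comp measurable_prodMk_right)
      (hGm.comp measurable_prodMk_right)
  have hU : IsOpen (Ioo 0 T ×ˢ (univ : Set E)) := isOpen_Ioo.prod isOpen_univ
  have key := hU.ae_eq_zero_of_integral_contDiff_smul_eq_zero
    (μ := (volume : Measure ℝ).prod ν) ((hWl.sub hPl).locallyIntegrableOn _) ?_
  · filter_upwards [key] with p hp hpT
    exact sub_eq_zero.1 (hp ⟨hpT, mem_univ _⟩)
  intro g hg hgc hgs
  have h0 : ∀ p : ℝ × E, p.1 ∉ Ioo 0 T → g p = 0 := fun p hp => by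
    by_contra hne
    exact hp (hgs (subset_tsupport _ hne)).1
  have hψ := contDiff_testPrimitive hg hgc h0
  have hψc := hasCompactSupport_testPrimitive hT hg.continuous hgc h0
  have hder : Continuous fun p => fderiv ℝ (testPrimitive T g) p ((1 : ℝ), (0 : E)) :=
    (hψ.continuous_fderiv (by simp)).clm_apply continuous_const
  have hderc : HasCompactSupport fun p => fderiv ℝ (testPrimitive T g) p ((1 : ℝ), (0 : E)) :=
    hψc.fderiv_apply ℝ _
  have i1 := (hWl.sub hPl).integrable_smul_left_of_hasCompactSupport hg.continuous hgc
  have i2 := hWl.integrable_smul_left_of_hasCompactSupport hder hderc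
  have i3 := hGl.integrable_smul_left_of_hasCompactSupport hψ.continuous hψc
  have hz := hweak _ hψ hψc (testPrimitive_eq_zero hT hg.continuous h0)
  have i4 := i2.add i3
  simp only [Pi.add_def] at i4
  rw [← integral_add i2 i3, integral_prod_symm _ i4] at hz
  rw [integral_prod_symm _ i1, ← hz]
  refine integral_congr_ae ?_
  filter_upwards [hWi, hGi] with q hq1 hq2
  have := integral_smul_sub_timePrimitive hT hq1 hq2 (f := fun t => g (t, q))
    (hg.continuous.comp (by fun_prop)) fun t ht => h0 _ ht
  simp only [Pi.sub_apply]
  rw [this]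
  refine integral_congr_ae (Eventually.of_forall fun t => ?_)
  simp only [fderiv_testPrimitive hg hgc h0, testPrimitive]

end Weak

end Transport

section Weight

variable {n : ℕ} {β : ℝ}

theorem one_le_omegaB (n : ℕ) (β : ℝ) (k ξ : En n) : 1 ≤ omegaB n β k ξ := by
  have h1 : 0 ≤ ‖k‖ ^ (β / (β + 1)) := by positivity
  have h2 : 0 ≤ ‖ξ‖ ^ β := by positivity
  rw [omegaB]; linarith

theorem continuous_omegaB (hβ : 0 < β) :
    Continuous fun q : En n × En n => omegaB n β q.1 q.2 := by
  have h : 0 ≤ β / (β + 1) := by positivity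
  unfold omegaB
  exact (continuous_const.add ((continuous_norm.comp continuous_fst).rpow_const
    fun _ => Or.inr h)).add ((continuous_norm.comp continuous_snd).rpow_const fun _ => Or.inr hβ.le)

/-- The radius, relative to the kinetic time scale `1 / ω`, within which `ω` is comparable along
free transport. -/
def scaleRadius (β : ℝ) : ℝ := (1 / 2) * (1 / 2 : ℝ) ^ (1 / β)

theorem scaleRadius_pos (β : ℝ) : 0 < scaleRadius β := by unfold scaleRadius; positivity

theorem omegaB_le_of_near (hβ : β ∈ Ioc (0 : ℝ) 2) {k ξ ξ' : En n} {r : ℝ}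
    (hr : r * omegaB n β k ξ ≤ scaleRadius β) (hξ : ‖ξ - ξ'‖ ≤ r * ‖k‖) :
    omegaB n β k ξ ≤ 8 * omegaB n β k ξ' := by
  obtain ⟨hβ0, hβ2⟩ := hβ
  have hω := one_le_omegaB n β k ξ
  set l := omegaB n β k ξ with hl
  have hl0 : 0 < l := by linarith
  have hkl : ‖k‖ ^ (β / (β + 1)) ≤ l := by
    have h2 : 0 ≤ ‖ξ‖ ^ β := by positivity
    rw [hl, omegaB]; linarith
  have hk : ‖k‖ ≤ l * l ^ (1 / β) := by
    calc ‖k‖ = (‖k‖ ^ (β / (β + 1))) ^ ((β + 1) / β) := by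
          rw [← Real.rpow_mul (norm_nonneg k), div_mul_div_cancel₀ (by positivity),
            div_self hβ0.ne', Real.rpow_one]
      _ ≤ l ^ ((β + 1) / β) := Real.rpow_le_rpow (by positivity) hkl (by positivity)
      _ = l * l ^ (1 / β) := by
          rw [add_div, div_self hβ0.ne', Real.rpow_add hl0, Real.rpow_one]
  have hrk : r * ‖k‖ ≤ scaleRadius β * l ^ (1 / β) := by
    rcases le_total r 0 with h | h
    · have h1 : r * ‖k‖ ≤ 0 := mul_nonpos_of_nonpos_of_nonneg h (norm_nonneg k)
      have h2 := scaleRadius_pos β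
      exact h1.trans (by positivity)
    · calc r * ‖k‖ ≤ r * (l * l ^ (1 / β)) := by gcongr
        _ = r * l * l ^ (1 / β) := by ring
        _ ≤ _ := by gcongr
  have htri : ‖ξ‖ ≤ ‖ξ'‖ + scaleRadius β * l ^ (1 / β) := by
    have := norm_add_le (ξ - ξ') ξ'
    rw [sub_add_cancel] at this
    linarith
  have hb : 0 ≤ scaleRadius β * l ^ (1 / β) := by have := scaleRadius_pos β; positivity
  have h4 : (2 : ℝ) ^ β ≤ 4 := by
    calc (2 : ℝ) ^ β ≤ 2 ^ (2 : ℝ) := Real.rpow_le_rpow_of_exponent_le (by norm_num) hβ2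
      _ = 4 := by norm_num
  have hpow1 : (2 * (scaleRadius β * l ^ (1 / β))) ^ β = l / 2 := by
    have : 2 * (scaleRadius β * l ^ (1 / β)) = (l / 2) ^ (1 / β) := by
      rw [scaleRadius, div_eq_mul_inv l, Real.mul_rpow hl0.le (by norm_num)]
      norm_num; ring
    rw [this, ← Real.rpow_mul (by positivity), one_div_mul_cancel hβ0.ne', Real.rpow_one]
  have hpow2 : (2 * ‖ξ'‖) ^ β ≤ 4 * ‖ξ'‖ ^ β := by
    rw [Real.mul_rpow (by norm_num) (norm_nonneg _)]
    gcongr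
  have hmain : ‖ξ‖ ^ β ≤ 4 * ‖ξ'‖ ^ β + l / 2 := by
    have hn : 0 ≤ 4 * ‖ξ'‖ ^ β := by positivity
    rcases le_total ‖ξ'‖ (scaleRadius β * l ^ (1 / β)) with h | h
    · calc ‖ξ‖ ^ β ≤ (2 * (scaleRadius β * l ^ (1 / β))) ^ β :=
            Real.rpow_le_rpow (norm_nonneg _) (by linarith) hβ0.le
        _ ≤ _ := by rw [hpow1]; linarith
    · calc ‖ξ‖ ^ β ≤ (2 * ‖ξ'‖) ^ β :=
            Real.rpow_le_rpow (norm_nonneg _) (by linarith) hβ0.le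
        _ ≤ _ := by linarith
  have hk0 : 0 ≤ ‖k‖ ^ (β / (β + 1)) := by positivity
  have hl' : l = 1 + ‖k‖ ^ (β / (β + 1)) + ‖ξ‖ ^ β := hl
  rw [omegaB]
  linarith

end Weight

section Averaging

theorem sq_lintegral_enorm_le {I : Set ℝ} {G : ℝ → ℂ} (hG : Measurable G) :
    (∫⁻ x in I, ‖G x‖ₑ) ^ 2 ≤ volume I * ∫⁻ x in I, ‖G x‖ₑ ^ 2 := by
  have h := ENNReal.lintegral_mul_le_Lp_mul_Lq (volume.restrict I)
    Real.HolderConjugate.two_two (f := fun x => ‖G x‖ₑ) (g := fun _ => 1)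
    hG.enorm.aemeasurable aemeasurable_const
  simp only [Pi.mul_apply, mul_one, ENNReal.one_rpow, lintegral_const, Measure.restrict_apply_univ,
    one_mul] at h
  calc (∫⁻ x in I, ‖G x‖ₑ) ^ 2 ≤ _ := pow_le_pow_left' h 2
    _ = volume I * ∫⁻ x in I, ‖G x‖ₑ ^ 2 := by
      rw [mul_pow, ← ENNReal.rpow_mul_natCast, ← ENNReal.rpow_mul_natCast]
      norm_num [mul_comm]

theorem add_sq_le_two_mul (a b : ℝ≥0∞) : (a + b) ^ 2 ≤ 2 * a ^ 2 + 2 * b ^ 2 := by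
  have := ENNReal.rpow_add_le_mul_rpow_add_rpow a b (p := 2) (by norm_num)
  norm_num [mul_add] at this
  exact this

theorem mul_sq_enorm_le_average {w G : ℝ → ℂ} (hG : Measurable G) {t l : ℝ}
    (hsub : ∀ τ ∈ Ioo (t - l) t, ‖w t - w τ‖ₑ ≤ ∫⁻ x in Ioo (t - l) t, ‖G x‖ₑ) :
    ENNReal.ofReal l * ‖w t‖ₑ ^ 2 ≤ 2 * (∫⁻ τ in Ioo (t - l) t, ‖w τ‖ₑ ^ 2)
      + 2 * ENNReal.ofReal l ^ 2 * ∫⁻ τ in Ioo (t - l) t, ‖G τ‖ₑ ^ 2 := by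
  have hv : volume (Ioo (t - l) t) = ENNReal.ofReal l := by
    rw [Real.volume_Ioo, sub_sub_cancel]
  set g := ∫⁻ x in Ioo (t - l) t, ‖G x‖ₑ with hg
  calc ENNReal.ofReal l * ‖w t‖ₑ ^ 2 = ∫⁻ _ in Ioo (t - l) t, ‖w t‖ₑ ^ 2 := by
        rw [setLIntegral_const, hv, mul_comm]
    _ ≤ ∫⁻ τ in Ioo (t - l) t, (2 * ‖w τ‖ₑ ^ 2 + 2 * g ^ 2) := by
        refine setLIntegral_mono' measurableSet_Ioo fun τ hτ => ?_
        refine le_trans (pow_le_pow_left' ?_ 2) (add_sq_le_two_mul _ _)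
        calc ‖w t‖ₑ = ‖w τ + (w t - w τ)‖ₑ := by rw [add_sub_cancel]
          _ ≤ _ := (enorm_add_le _ _).trans (add_le_add le_rfl (hsub τ hτ))
    _ = 2 * (∫⁻ τ in Ioo (t - l) t, ‖w τ‖ₑ ^ 2) + ENNReal.ofReal l * (2 * g ^ 2) := by
        rw [lintegral_add_right _ measurable_const, lintegral_const_mul' _ _ (by simp),
          setLIntegral_const, hv, mul_comm (2 * g ^ 2)]
    _ ≤ _ := by
        have := sq_lintegral_enorm_le (I := Ioo (t - l) t) hG
        rw [hv] at this
        calc _ ≤ 2 * (∫⁻ τ in Ioo (t - l) t, ‖w τ‖ₑ ^ 2) + ENNReal.ofReal l *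
              (2 * (ENNReal.ofReal l * ∫⁻ x in Ioo (t - l) t, ‖G x‖ₑ ^ 2)) := by gcongr
          _ = _ := by ring

end Averaging

section Characteristics

variable {n : ℕ}

/-- Free transport on the Fourier side: `(k, ξ) ↦ (k, ξ + t k)`. -/
def shear (n : ℕ) (t : ℝ) : (En n × En n) ≃ₜ (En n × En n) where
  toFun q := (q.1, q.2 + t • q.1)
  invFun q := (q.1, q.2 - t • q.1)
  left_inv q := by simp
  right_inv q := by simp
  continuous_toFun := by fun_prop
  continuous_invFun := by fun_prop

theorem shear_apply (t : ℝ) (q : En n × En n) : shear n t q = (q.1, q.2 + t • q.1) := rfl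

theorem measurePreserving_shear (t : ℝ) :
    MeasurePreserving (shear n t) (volume : Measure (En n × En n)) volume := by
  have := MeasurePreserving.skew_product (MeasurePreserving.id (volume : Measure (En n)))
    (μc := (volume : Measure (En n))) (μd := volume) (g := fun k ξ => ξ + t • k)
    (by fun_prop) (Eventually.of_forall fun k => map_add_right_eq_self _ _)
  exact this

/-- `U` followed along the characteristics of free transport, and extended by zero outside
`(0, T)`. -/
def alongChar (n : ℕ) (T : ℝ) (U : ℝ → En n → En n → ℂ) (p : ℝ × (En n × En n)) : ℂ :=
  indicator (Ioo 0 T) (fun t => U t p.2.1 (p.2.2 - t • p.2.1)) p.1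

theorem alongChar_of_mem {T t : ℝ} (ht : t ∈ Ioo 0 T) (U : ℝ → En n → En n → ℂ)
    (q : En n × En n) : alongChar n T U (t, q) = U t q.1 (q.2 - t • q.1) :=
  indicator_of_mem ht _

theorem alongChar_shear {T t : ℝ} (ht : t ∈ Ioo 0 T) (U : ℝ → En n → En n → ℂ)
    (q : En n × En n) : alongChar n T U (t, shear n t q) = U t q.1 q.2 := by
  rw [alongChar_of_mem ht, shear_apply, add_sub_cancel_right]

theorem measurable_alongChar {T : ℝ} {U : ℝ → En n → En n → ℂ} (hU : MeasU n U) :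
    Measurable (alongChar n T U) := by
  have h : Measurable fun p : ℝ × (En n × En n) => U p.1 p.2.1 (p.2.2 - p.1 • p.2.1) :=
    hU.comp (g := fun p : ℝ × En n × En n => U p.1 p.2.1 p.2.2)
      (f := fun p : ℝ × En n × En n => (p.1, p.2.1, p.2.2 - p.1 • p.2.1)) (by fun_prop)
  exact h.indicator (measurableSet_Ioo.preimage measurable_fst)

/-- The weighted density, on a characteristic, of the squared `X_β^σ` norm. -/
def charDensity (n : ℕ) (β σ T : ℝ) (U : ℝ → En n → En n → ℂ) (p : ℝ × (En n × En n)) : ℝ≥0∞ :=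
  ENNReal.ofReal (omegaB n β p.2.1 (p.2.2 - p.1 • p.2.1) ^ (2 * σ) * ‖alongChar n T U p‖ ^ 2)

/-- The squared `L²_μ((0,T); X_β^σ)` norm along a single characteristic. -/
def charEnergy (n : ℕ) (β σ T μ : ℝ) (U : ℝ → En n → En n → ℂ) (q : En n × En n) : ℝ≥0∞ :=
  ∫⁻ t in Ioo 0 T, ENNReal.ofReal (t ^ (2 - 2 * μ)) * charDensity n β σ T U (t, q)

variable {β σ T μ : ℝ} {U : ℝ → En n → En n → ℂ}

theorem measurable_charDensity (hβ : 0 < β) (hU : MeasU n U) :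
    Measurable (charDensity n β σ T U) := by
  have h1 : Measurable fun p : ℝ × (En n × En n) => omegaB n β p.2.1 (p.2.2 - p.1 • p.2.1) :=
    ((continuous_omegaB (n := n) hβ).comp (f := fun p : ℝ × (En n × En n) =>
      (p.2.1, p.2.2 - p.1 • p.2.1)) (by fun_prop)).measurable
  exact ((h1.pow_const _).mul ((measurable_alongChar hU).norm.pow_const 2)).ennreal_ofReal

theorem measurable_charEnergy_integrand (hβ : 0 < β) (hU : MeasU n U) :
    Measurable fun p : ℝ × (En n × En n) =>
      ENNReal.ofReal (p.1 ^ (2 - 2 * μ)) * charDensity n β σ T U p :=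
  (measurable_fst.pow_const _).ennreal_ofReal.mul (measurable_charDensity hβ hU)

theorem measurable_charEnergy (hβ : 0 < β) (hU : MeasU n U) :
    Measurable (charEnergy n β σ T μ U) :=
  (measurable_charEnergy_integrand hβ hU).lintegral_prod_left'

theorem Xnorm_eq_lintegral (hβ : 0 < β) {w : En n → En n → ℂ}
    (hw : Measurable fun q : En n × En n => w q.1 q.2) :
    Xnorm n β σ w = ∫⁻ q : En n × En n,
      ENNReal.ofReal (omegaB n β q.1 q.2 ^ (2 * σ) * ‖w q.1 q.2‖ ^ 2) := by
  have hm : Measurable fun q : En n × En n =>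
      ENNReal.ofReal (omegaB n β q.1 q.2 ^ (2 * σ) * ‖w q.1 q.2‖ ^ 2) :=
    (((continuous_omegaB hβ).measurable.pow_const _).mul (hw.norm.pow_const 2)).ennreal_ofReal
  rw [Measure.volume_eq_prod, lintegral_prod _ hm.aemeasurable]
  rfl

theorem lintegral_charEnergy (hβ : 0 < β) (hU : MeasU n U) :
    ∫⁻ q, charEnergy n β σ T μ U q = L2X n β σ T μ U := by
  unfold charEnergy L2X
  rw [lintegral_lintegral_swap (μ := (volume : Measure (En n × En n))) (f := fun q t =>
    ENNReal.ofReal (t ^ (2 - 2 * μ)) * charDensity n β σ T U (t, q))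
    ((measurable_charEnergy_integrand hβ hU).comp measurable_swap).aemeasurable]
  refine setLIntegral_congr_fun measurableSet_Ioo fun t ht => ?_
  beta_reduce
  rw [lintegral_const_mul' _ _ ENNReal.ofReal_ne_top]
  congr 1
  have hUt : Measurable fun q : En n × En n => U t q.1 q.2 := hU.comp measurable_prodMk_left
  rw [Xnorm_eq_lintegral hβ hUt, ← (measurePreserving_shear (n := n) t).lintegral_comp
    (f := fun q => charDensity n β σ T U (t, q))
    ((measurable_charDensity hβ hU).comp measurable_prodMk_left)]
  refine lintegral_congr fun q => ?_
  rw [charDensity, alongChar_shear ht]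
  simp [shear_apply]

end Characteristics

section WeakForm

open scoped ContDiff Topology

variable {n : ℕ} {β σ T μ : ℝ} {U H : ℝ → En n → En n → ℂ}

theorem lintegral_enorm_alongChar_le (hσ : 0 ≤ σ) (q : En n × En n) :
    ∫⁻ t, ‖alongChar n T U (t, q)‖ₑ ≤
      charEnergy n β σ T μ U q + ∫⁻ t in Ioo 0 T, ENNReal.ofReal (t ^ (2 * μ - 2)) := by
  have hmeas : Measurable fun t : ℝ => ENNReal.ofReal (t ^ (2 * μ - 2)) :=
    (measurable_id.pow_const _).ennreal_ofReal
  rw [charEnergy, ← lintegral_add_right _ hmeas,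
    ← setLIntegral_eq_of_support_subset (s := Ioo 0 T)]
  · refine setLIntegral_mono' measurableSet_Ioo fun t ht => ?_
    rw [charDensity, ← ENNReal.ofReal_mul (Real.rpow_nonneg ht.1.le _),
      ← ENNReal.ofReal_add (by
        have := one_le_omegaB n β q.1 (q.2 - t • q.1)
        have := ht.1
        positivity) (Real.rpow_nonneg ht.1.le _), ← ofReal_norm]
    refine ENNReal.ofReal_le_ofReal ?_
    have hω : 1 ≤ omegaB n β q.1 (q.2 - t • q.1) ^ (2 * σ) :=
      Real.one_le_rpow (one_le_omegaB _ _ _ _) (by positivity)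
    have ha : 0 < t ^ (2 - 2 * μ) := Real.rpow_pos_of_pos ht.1 _
    have hb : 0 < t ^ (2 * μ - 2) := Real.rpow_pos_of_pos ht.1 _
    have hab : t ^ (2 - 2 * μ) * t ^ (2 * μ - 2) = 1 := by
      rw [← Real.rpow_add ht.1]; norm_num
    dsimp only
    set x := ‖alongChar n T U (t, q)‖
    set a := t ^ (2 - 2 * μ)
    set b := t ^ (2 * μ - 2)
    have hx : 0 ≤ x := norm_nonneg _
    have h1 : a * (1 * x ^ 2) ≤ a * (omegaB n β q.1 (q.2 - t • q.1) ^ (2 * σ) * x ^ 2) := by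
      gcongr
    nlinarith [mul_nonneg hb.le (sq_nonneg (a * x - 1)), mul_nonneg hb.le hx]
  · intro t ht
    by_contra h
    exact ht (by simp [alongChar, h])

theorem lintegral_rpow_Ioo_lt_top (hμ : 1 / 2 < μ) :
    ∫⁻ t in Ioo 0 T, ENNReal.ofReal (t ^ (2 * μ - 2)) < ⊤ := by
  rcases le_or_gt T 0 with hT | hT
  · simp [Ioo_eq_empty_of_le hT]
  have h := (intervalIntegral.intervalIntegrable_rpow' (a := 0) (b := T) (r := 2 * μ - 2)
    (by linarith)).1
  have h2 : IntegrableOn (fun t : ℝ => t ^ (2 * μ - 2)) (Ioo 0 T) := h.mono_set Ioo_subset_Ioc_self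
  exact lt_of_le_of_lt (lintegral_mono fun t => Real.ofReal_le_enorm _) h2.2

theorem ae_charEnergy_lt_top (hβ : 0 < β) (hU : MeasU n U) (hfin : L2X n β σ T μ U < ⊤) :
    ∀ᵐ q, charEnergy n β σ T μ U q < ⊤ :=
  ae_lt_top (measurable_charEnergy hβ hU) (by rw [lintegral_charEnergy hβ hU]; exact hfin.ne)

theorem ae_integrable_alongChar (hβ : 0 < β) (hσ : 0 ≤ σ) (hμ : 1 / 2 < μ) (hU : MeasU n U)
    (hfin : L2X n β σ T μ U < ⊤) :
    ∀ᵐ q : En n × En n, Integrable fun t => alongChar n T U (t, q) := by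
  filter_upwards [ae_charEnergy_lt_top hβ hU hfin] with q hq
  exact ⟨((measurable_alongChar hU).comp measurable_prodMk_right).aestronglyMeasurable,
    (lintegral_enorm_alongChar_le hσ q).trans_lt
      (ENNReal.add_lt_top.2 ⟨hq, lintegral_rpow_Ioo_lt_top hμ⟩)⟩

theorem lintegral_lintegral_alongChar_ne_top (hβ : 0 < β) (hσ : 0 ≤ σ) (hμ : 1 / 2 < μ)
    (hU : MeasU n U) (hfin : L2X n β σ T μ U < ⊤) {K : Set (En n × En n)} (hK : IsCompact K) :
    ∫⁻ q in K, (∫⁻ t, ‖alongChar n T U (t, q)‖ₑ) ≠ ⊤ := by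
  refine ne_top_of_le_ne_top ?_ (lintegral_mono fun q =>
    lintegral_enorm_alongChar_le (β := β) (μ := μ) hσ q)
  rw [lintegral_add_right _ measurable_const, setLIntegral_const]
  refine ENNReal.add_ne_top.2 ⟨ne_top_of_le_ne_top hfin.ne ?_,
    ENNReal.mul_ne_top (lintegral_rpow_Ioo_lt_top hμ).ne hK.measure_lt_top.ne⟩
  rw [← lintegral_charEnergy hβ hU]
  exact setLIntegral_le_lintegral _ _

instance isAddHaarMeasure_volume_phaseSpace :
    (volume : Measure (En n × En n)).IsAddHaarMeasure :=
  inferInstanceAs (Measure.IsAddHaarMeasure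
    ((volume : Measure (En n)).prod (volume : Measure (En n))))

theorem locallyIntegrable_alongChar (hβ : 0 < β) (hσ : 0 ≤ σ) (hμ : 1 / 2 < μ)
    (hU : MeasU n U) (hfin : L2X n β σ T μ U < ⊤) :
    LocallyIntegrable (alongChar n T U) (volume.prod volume) :=
  locallyIntegrable_of_lintegral_lintegral (measurable_alongChar hU).aestronglyMeasurable
    fun _ _ _ hK => ne_top_of_le_ne_top
      (lintegral_lintegral_alongChar_ne_top hβ hσ hμ hU hfin hK)
      (lintegral_mono fun _ => setLIntegral_le_lintegral _ _)

theorem integral_smul_alongChar (hU : LocallyIntegrable (alongChar n T U) (volume.prod volume))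
    {χ : ℝ × (En n × En n) → ℝ} (hχ : Continuous χ) (hc : HasCompactSupport χ) :
    ∫ p, χ p • alongChar n T U p ∂(volume.prod volume) =
      ∫ t in Ioo 0 T, ∫ q : En n × En n, U t q.1 q.2 * (χ (t, shear n t q) : ℂ) := by
  rw [integral_prod _ (hU.integrable_smul_left_of_hasCompactSupport hχ hc),
    ← setIntegral_eq_integral_of_forall_compl_eq_zero (s := Ioo 0 T)]
  · refine setIntegral_congr_fun measurableSet_Ioo fun t ht => ?_
    beta_reduce
    rw [← (measurePreserving_shear (n := n) t).integral_comp (shear n t).measurableEmbedding]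
    refine integral_congr_ae (Eventually.of_forall fun q => ?_)
    beta_reduce
    rw [alongChar_shear ht, Complex.real_smul, mul_comm]
  · intro t ht
    simp [alongChar, ht]

/-- Along characteristics, the kinetic transport derivative becomes the time derivative. -/
theorem IsFTransportDeriv.integral_alongChar (h : IsFTransportDeriv n T U H)
    (hU : LocallyIntegrable (alongChar n T U) (volume.prod volume))
    (hH : LocallyIntegrable (alongChar n T H) (volume.prod volume))
    {ψ : ℝ × (En n × En n) → ℝ} (hψ : ContDiff ℝ ∞ ψ) (hc : HasCompactSupport ψ)
    (h0 : ∀ p : ℝ × (En n × En n), p.1 ∉ Ioo 0 T → ψ p = 0) :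
    ∫ p, fderiv ℝ ψ p (1, 0) • alongChar n T U p ∂(volume.prod volume)
      + ∫ p, ψ p • alongChar n T H p ∂(volume.prod volume) = 0 := by
  let e : (ℝ × (En n × En n)) ≃ₜ (ℝ × (En n × En n)) :=
    { toFun := fun p => (p.1, p.2.1, p.2.2 + p.1 • p.2.1)
      invFun := fun p => (p.1, p.2.1, p.2.2 - p.1 • p.2.1)
      left_inv := fun p => by simp
      right_inv := fun p => by simp
      continuous_toFun := by fun_prop
      continuous_invFun := by fun_prop }
  have heC : ContDiff ℝ ∞ e := by
    change ContDiff ℝ ∞ fun p : ℝ × (En n × En n) => (p.1, p.2.1, p.2.2 + p.1 • p.2.1)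
    fun_prop
  have key := h (ψ ∘ e) (hψ.comp heC) (hc.comp_homeomorph e) (fun p hp => h0 _ hp)
  have hcont : Continuous fun p => fderiv ℝ ψ p (1, 0) :=
    (hψ.continuous_fderiv (by simp)).clm_apply continuous_const
  rw [integral_smul_alongChar hU hcont (hc.fderiv_apply ℝ _),
    integral_smul_alongChar hH hψ.continuous hc]
  have hd : ∀ (t : ℝ) (q : En n × En n),
      fderiv ℝ (ψ ∘ e) (t, q) (1, (0, -q.1)) = fderiv ℝ ψ (t, shear n t q) (1, 0) := by
    intro t q
    rw [fderiv_comp _ (hψ.differentiable (by simp) _) (heC.differentiable (by simp) _)]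
    let L := ContinuousLinearMap.snd ℝ ℝ (En n × En n)
    let L₀ := ContinuousLinearMap.fst ℝ ℝ (En n × En n)
    let L₁ := ContinuousLinearMap.fst ℝ (En n) (En n)
    let L₂ := ContinuousLinearMap.snd ℝ (En n) (En n)
    have hee : HasFDerivAt e (L₀.prod ((L₁.comp L).prod
        (L₂.comp L + (t • L₁.comp L + L₀.smulRight q.1)))) (t, q) := by
      have h1 : HasFDerivAt (fun p : ℝ × (En n × En n) => p.2.1) (L₁.comp L) (t, q) :=
        (L₁.comp L).hasFDerivAt
      have h2 : HasFDerivAt (fun p : ℝ × (En n × En n) => p.2.2) (L₂.comp L) (t, q) :=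
        (L₂.comp L).hasFDerivAt
      have h3 : HasFDerivAt (fun p : ℝ × (En n × En n) => p.1) L₀ (t, q) := hasFDerivAt_fst
      exact h3.prodMk (h1.prodMk (h2.add (h3.smul h1)))
    rw [hee.fderiv]
    simp [e, L, L₀, L₁, L₂, shear_apply, ← Prod.zero_eq_mk]
  simp only [hd] at key
  have key2 : ∀ x y : ℂ, -x = y → x + y = 0 := by rintro x y rfl; ring
  exact key2 _ _ key

end WeakForm

section Representative

variable {n : ℕ} {β s σ T μ : ℝ} {U H : ℝ → En n → En n → ℂ}

/-- The time-continuous representative of `U`, read along characteristics. -/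
def charRep (n : ℕ) (T : ℝ) (U H : ℝ → En n → En n → ℂ) (t : ℝ) (q : En n × En n) : ℂ :=
  timePrimitive T (fun τ => alongChar n T U (τ, q)) (fun τ => alongChar n T H (τ, q)) t

/-- The time-continuous representative of `U`. -/
def timeRep (n : ℕ) (T : ℝ) (U H : ℝ → En n → En n → ℂ) (t : ℝ) (k ξ : En n) : ℂ :=
  charRep n T U H t (shear n t (k, ξ))

theorem measurable_charRep (hU : MeasU n U) (hH : MeasU n H) :
    Measurable fun p : ℝ × (En n × En n) => charRep n T U H p.1 p.2 := by
  have h1 : Measurable fun z : (ℝ × (En n × En n)) × ℝ => alongChar n T U (z.2, z.1.2) :=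
    (measurable_alongChar hU).comp (by fun_prop)
  have h2 : Measurable fun z : (ℝ × (En n × En n)) × ℝ => alongChar n T H (z.2, z.1.2) :=
    (measurable_alongChar hH).comp (by fun_prop)
  have h3 : Measurable fun z : (ℝ × (En n × En n)) × ℝ => deriv (timeCutoff T) z.2 :=
    (continuous_deriv_timeCutoff T).measurable.comp measurable_snd
  have h4 : Measurable fun z : (ℝ × (En n × En n)) × ℝ =>
      timeCutoff T z.2 - if z.1.1 < z.2 then (1 : ℝ) else 0 :=
    (measurable_timeCutoff_sub T).comp (f := fun z : (ℝ × (En n × En n)) × ℝ => (z.1.1, z.2))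
      (by fun_prop)
  exact ((h3.smul h1).add (h4.smul h2)).stronglyMeasurable.integral_prod_right.measurable

theorem measurable_charRep_apply (hU : MeasU n U) (hH : MeasU n H) (t : ℝ) :
    Measurable (charRep n T U H t) :=
  (measurable_charRep hU hH).comp measurable_prodMk_left

theorem measurable_timeRep (hU : MeasU n U) (hH : MeasU n H) (t : ℝ) :
    Measurable fun q : En n × En n => timeRep n T U H t q.1 q.2 :=
  (measurable_charRep_apply hU hH t).comp (shear n t).measurable

theorem ae_alongChar_eq_charRep (hT : 0 < T) (hβ : 0 < β) (hs : 0 ≤ s) (hμ : 1 / 2 < μ)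
    (hU : MeasU n U) (hH : MeasU n H) (h : IsFTransportDeriv n T U H)
    (hUf : L2X n β s T μ U < ⊤) (hHf : L2X n β s T μ H < ⊤) :
    ∀ᵐ p : ℝ × (En n × En n) ∂(volume.prod volume), p.1 ∈ Ioo 0 T →
      alongChar n T U p = charRep n T U H p.1 p.2 :=
  ae_eq_timePrimitive hT (measurable_alongChar hU) (measurable_alongChar hH)
    (fun _ hK => lintegral_lintegral_alongChar_ne_top hβ hs hμ hU hUf hK)
    (fun _ hK => lintegral_lintegral_alongChar_ne_top hβ hs hμ hH hHf hK)
    (ae_integrable_alongChar hβ hs hμ hU hUf) (ae_integrable_alongChar hβ hs hμ hH hHf)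
    (fun _ hψ hc h0 => h.integral_alongChar (locallyIntegrable_alongChar hβ hs hμ hU hUf)
      (locallyIntegrable_alongChar hβ hs hμ hH hHf) hψ hc h0)
    (measurable_charRep hU hH).aestronglyMeasurable

theorem ae_timeRep_eq
    (h : ∀ᵐ p : ℝ × (En n × En n) ∂(volume.prod volume), p.1 ∈ Ioo 0 T →
      alongChar n T U p = charRep n T U H p.1 p.2) :
    ∀ᵐ t ∂(volume.restrict (Ioo 0 T)), ∀ᵐ (k : En n) ∂(volume : Measure (En n)),
      ∀ᵐ (ξ : En n) ∂(volume : Measure (En n)), timeRep n T U H t k ξ = U t k ξ := by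
  rw [ae_restrict_iff' measurableSet_Ioo]
  filter_upwards [Measure.ae_ae_of_ae_prod h] with t ht hmem
  have h1 : ∀ᵐ q : En n × En n, timeRep n T U H t q.1 q.2 = U t q.1 q.2 := by
    filter_upwards [(measurePreserving_shear (n := n) t).quasiMeasurePreserving.ae ht] with q hq
    rw [timeRep, ← alongChar_shear hmem U q]
    exact (hq hmem).symm
  exact Measure.ae_ae_of_ae_prod h1

theorem ae_ae_alongChar_eq_charRep
    (h : ∀ᵐ p : ℝ × (En n × En n) ∂(volume.prod volume), p.1 ∈ Ioo 0 T →
      alongChar n T U p = charRep n T U H p.1 p.2) :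
    ∀ᵐ q : En n × En n, ∀ᵐ t : ℝ, t ∈ Ioo 0 T →
      alongChar n T U (t, q) = charRep n T U H t q :=
  Measure.ae_ae_of_ae_prod
    ((Measure.measurePreserving_swap (μ := (volume : Measure (En n × En n)))
      (ν := (volume : Measure ℝ))).quasiMeasurePreserving.ae h)

end Representative

section PointwiseBound

variable {n : ℕ} {β s σ T μ : ℝ} {U H : ℝ → En n → En n → ℂ}

theorem ofReal_mul_lintegral_sq_le_charEnergy (hσ : 0 ≤ σ) (hμ : μ ≤ 1) {a b c d : ℝ} (hd : 0 < d)
    (ha : d ≤ a) (hb : b ≤ T) (hc : 0 ≤ c) {q : En n × En n}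
    (hω : ∀ τ ∈ Ioo a b, c ≤ 8 * omegaB n β q.1 (q.2 - τ • q.1)) :
    ENNReal.ofReal (d ^ (2 - 2 * μ) * c ^ (2 * σ)) *
      ∫⁻ τ in Ioo a b, ‖alongChar n T U (τ, q)‖ₑ ^ 2 ≤
      ENNReal.ofReal (8 ^ (2 * σ)) * charEnergy n β σ T μ U q := by
  have hsub : Ioo a b ⊆ Ioo 0 T := Ioo_subset_Ioo (hd.le.trans ha) hb
  rw [charEnergy, ← lintegral_const_mul' _ _ ENNReal.ofReal_ne_top,
    ← lintegral_const_mul' _ _ ENNReal.ofReal_ne_top]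
  refine le_trans (setLIntegral_mono' measurableSet_Ioo fun τ hτ => ?_)
    (lintegral_mono_set hsub)
  have hτ0 : 0 < τ := (hsub hτ).1
  have hτd : d ≤ τ := ha.trans hτ.1.le
  rw [charDensity, ← ofReal_norm, ← ENNReal.ofReal_pow (norm_nonneg _),
    ← ENNReal.ofReal_mul (by positivity), ← ENNReal.ofReal_mul (by positivity),
    ← ENNReal.ofReal_mul (by positivity)]
  refine ENNReal.ofReal_le_ofReal ?_
  have hω0 : 0 ≤ omegaB n β q.1 (q.2 - τ • q.1) :=
    zero_le_one.trans (one_le_omegaB _ _ _ _)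
  have h1 : d ^ (2 - 2 * μ) ≤ τ ^ (2 - 2 * μ) := Real.rpow_le_rpow hd.le hτd (by linarith)
  have h2 : c ^ (2 * σ) ≤ 8 ^ (2 * σ) * omegaB n β q.1 (q.2 - τ • q.1) ^ (2 * σ) := by
    rw [← Real.mul_rpow (by norm_num) hω0]
    exact Real.rpow_le_rpow hc (hω τ hτ) (by positivity)
  calc _ ≤ τ ^ (2 - 2 * μ) * (8 ^ (2 * σ) * omegaB n β q.1 (q.2 - τ • q.1) ^ (2 * σ)) *
        ‖alongChar n T U (τ, q)‖ ^ 2 := by gcongr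
    _ = _ := by dsimp only; ring

/-- The length, in units of `1 / ω`, of the time window used to bound the trace at times at
least `δ`. -/
def windowScale (β δ : ℝ) : ℝ := min (scaleRadius β) (δ / 2)

theorem windowScale_pos {δ : ℝ} (hδ : 0 < δ) : 0 < windowScale β δ :=
  lt_min (scaleRadius_pos β) (by positivity)

/-- The constant in the pointwise trace estimate. -/
def traceConst (β s μ δ : ℝ) : ℝ :=
  ((δ / 2) ^ (2 - 2 * μ) * windowScale β δ)⁻¹ *
    (2 * 8 ^ (2 * (s + 1)) + 2 * windowScale β δ ^ 2 * 8 ^ (2 * s))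

theorem enorm_charRep_sub_le (hT : 0 < T) {q : En n × En n}
    (hUi : Integrable fun t => alongChar n T U (t, q))
    (hHi : Integrable fun t => alongChar n T H (t, q)) {a t τ : ℝ} (hτ : τ ∈ Ioo a t) :
    ‖charRep n T U H t q - charRep n T U H τ q‖ₑ ≤
      ∫⁻ x in Ioo a t, ‖alongChar n T H (x, q)‖ₑ := by
  rw [charRep, charRep, timePrimitive_sub hT hUi hHi hτ.2.le]
  refine (enorm_integral_le_lintegral_enorm _).trans ?_
  rw [restrict_Ioo_eq_restrict_Ioc]
  exact lintegral_mono_set (Ioc_subset_Ioc_left hτ.1.le)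

theorem ofReal_omegaB_mul_charRep_le (hT : 0 < T) (hβ : β ∈ Ioc (0 : ℝ) 2) (hs : 0 ≤ s)
    (hμ : μ ≤ 1) (hH : MeasU n H) {q : En n × En n}
    (hUi : Integrable fun t => alongChar n T U (t, q))
    (hHi : Integrable fun t => alongChar n T H (t, q))
    (hae : ∀ᵐ t : ℝ, t ∈ Ioo 0 T → alongChar n T U (t, q) = charRep n T U H t q)
    {δ t : ℝ} (hδ : 0 < δ) (ht : t ∈ Icc δ T) :
    ENNReal.ofReal (omegaB n β q.1 (q.2 - t • q.1) ^ (2 * (s + 1 / 2)) * ‖charRep n T U H t q‖ ^ 2)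
      ≤ ENNReal.ofReal (traceConst β s μ δ) *
        (charEnergy n β (s + 1) T μ U q + charEnergy n β s T μ H q) := by
  set c := omegaB n β q.1 (q.2 - t • q.1) with hc
  have hc1 : 1 ≤ c := one_le_omegaB _ _ _ _
  have hc0 : 0 < c := by linarith
  set e := windowScale β δ with he
  have he0 : 0 < e := windowScale_pos hδ
  have heR : e ≤ scaleRadius β := min_le_left _ _
  have heδ : e ≤ δ / 2 := min_le_right _ _
  set l := e / c with hl
  have hl0 : 0 < l := by positivity
  have hle : l ≤ δ / 2 := (div_le_self he0.le hc1).trans heδ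
  have hlc : l * c = e := div_mul_cancel₀ _ hc0.ne'
  set a := (δ / 2) ^ (2 - 2 * μ) with ha
  have ha0 : 0 < a := Real.rpow_pos_of_pos (by positivity) _
  have hω : ∀ τ ∈ Ioo (t - l) t, c ≤ 8 * omegaB n β q.1 (q.2 - τ • q.1) := by
    intro τ hτ
    refine omegaB_le_of_near hβ (hlc.le.trans heR) ?_
    rw [sub_sub_sub_cancel_left, ← sub_smul, norm_smul, Real.norm_eq_abs]
    gcongr
    rw [abs_le]; constructor <;> linarith [hτ.1, hτ.2]
  have hd : δ / 2 ≤ t - l := by linarith [ht.1]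
  have hA := ofReal_mul_lintegral_sq_le_charEnergy (U := U) (μ := μ) (by linarith : 0 ≤ s + 1) hμ
    (half_pos hδ) hd ht.2 hc0.le hω
  have hB := ofReal_mul_lintegral_sq_le_charEnergy (U := H) (μ := μ) hs hμ
    (half_pos hδ) hd ht.2 hc0.le hω
  have havg := mul_sq_enorm_le_average (w := fun t => charRep n T U H t q)
    (G := fun t => alongChar n T H (t, q)) ((measurable_alongChar hH).comp measurable_prodMk_right)
    (t := t) (l := l) fun τ hτ => enorm_charRep_sub_le hT hUi hHi hτ
  have hcongr : ∫⁻ τ in Ioo (t - l) t, ‖charRep n T U H τ q‖ₑ ^ 2 =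
      ∫⁻ τ in Ioo (t - l) t, ‖alongChar n T U (τ, q)‖ₑ ^ 2 := by
    refine setLIntegral_congr_fun_ae measurableSet_Ioo ?_
    filter_upwards [hae] with τ hτ hmem
    rw [hτ ⟨by linarith [hmem.1], hmem.2.trans_le ht.2⟩]
  rw [hcongr] at havg
  set A := ∫⁻ τ in Ioo (t - l) t, ‖alongChar n T U (τ, q)‖ₑ ^ 2
  set B := ∫⁻ τ in Ioo (t - l) t, ‖alongChar n T H (τ, q)‖ₑ ^ 2
  set EU := charEnergy n β (s + 1) T μ U q
  set EH := charEnergy n β s T μ H q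
  have hpow : c ^ (2 * (s + 1)) * l = e * c ^ (2 * (s + 1 / 2)) := by
    rw [show 2 * (s + 1) = 2 * (s + 1 / 2) + 1 by ring, Real.rpow_add hc0, Real.rpow_one, ← hlc]
    ring
  have hpow2 : c ^ (2 * (s + 1)) * l ^ 2 = e ^ 2 * c ^ (2 * s) := by
    rw [show 2 * (s + 1) = 2 * s + 1 + 1 by ring, Real.rpow_add hc0, Real.rpow_add hc0,
      Real.rpow_one, ← hlc]
    ring
  have hmain : ENNReal.ofReal (a * e) *
      ENNReal.ofReal (c ^ (2 * (s + 1 / 2)) * ‖charRep n T U H t q‖ ^ 2) ≤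
      ENNReal.ofReal (2 * 8 ^ (2 * (s + 1)) + 2 * e ^ 2 * 8 ^ (2 * s)) * (EU + EH) := by
    calc ENNReal.ofReal (a * e) *
          ENNReal.ofReal (c ^ (2 * (s + 1 / 2)) * ‖charRep n T U H t q‖ ^ 2)
        = ENNReal.ofReal (a * c ^ (2 * (s + 1))) *
            (ENNReal.ofReal l * ‖charRep n T U H t q‖ₑ ^ 2) := by
          rw [← ofReal_norm, ← ENNReal.ofReal_pow (norm_nonneg _),
            ← ENNReal.ofReal_mul (by positivity), ← ENNReal.ofReal_mul (by positivity),
            ← ENNReal.ofReal_mul (by positivity)]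
          congr 1
          linear_combination (-(a * ‖charRep n T U H t q‖ ^ 2)) * hpow
      _ ≤ ENNReal.ofReal (a * c ^ (2 * (s + 1))) * (2 * A + 2 * ENNReal.ofReal l ^ 2 * B) := by
          gcongr
      _ = 2 * (ENNReal.ofReal (a * c ^ (2 * (s + 1))) * A) +
            2 * ENNReal.ofReal (e ^ 2) * (ENNReal.ofReal (a * c ^ (2 * s)) * B) := by
          have : ENNReal.ofReal (a * c ^ (2 * (s + 1))) * ENNReal.ofReal l ^ 2 =
              ENNReal.ofReal (e ^ 2) * ENNReal.ofReal (a * c ^ (2 * s)) := by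
            rw [← ENNReal.ofReal_pow hl0.le, ← ENNReal.ofReal_mul (by positivity),
              ← ENNReal.ofReal_mul (by positivity)]
            congr 1
            linear_combination a * hpow2
          calc _ = 2 * (ENNReal.ofReal (a * c ^ (2 * (s + 1))) * A) + 2 *
                (ENNReal.ofReal (a * c ^ (2 * (s + 1))) * ENNReal.ofReal l ^ 2) * B := by ring
            _ = _ := by rw [this]; ring
      _ ≤ 2 * (ENNReal.ofReal (8 ^ (2 * (s + 1))) * EU) +
            2 * ENNReal.ofReal (e ^ 2) * (ENNReal.ofReal (8 ^ (2 * s)) * EH) := by gcongr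
      _ = ENNReal.ofReal (2 * 8 ^ (2 * (s + 1))) * EU +
            ENNReal.ofReal (2 * e ^ 2 * 8 ^ (2 * s)) * EH := by
          rw [ENNReal.ofReal_mul zero_le_two, ENNReal.ofReal_mul (by positivity),
            ENNReal.ofReal_mul zero_le_two, ENNReal.ofReal_ofNat]
          ring
      _ ≤ _ := by
          rw [mul_add _ EU EH]
          gcongr
          · exact le_add_of_nonneg_right (by positivity)
          · exact le_add_of_nonneg_left (by positivity)
  calc ENNReal.ofReal (c ^ (2 * (s + 1 / 2)) * ‖charRep n T U H t q‖ ^ 2)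
      = ENNReal.ofReal (a * e)⁻¹ * (ENNReal.ofReal (a * e) *
        ENNReal.ofReal (c ^ (2 * (s + 1 / 2)) * ‖charRep n T U H t q‖ ^ 2)) := by
        rw [← mul_assoc, ← ENNReal.ofReal_mul (by positivity),
          inv_mul_cancel₀ (by positivity), ENNReal.ofReal_one, one_mul]
    _ ≤ ENNReal.ofReal (a * e)⁻¹ *
        (ENNReal.ofReal (2 * 8 ^ (2 * (s + 1)) + 2 * e ^ 2 * 8 ^ (2 * s)) * (EU + EH)) := by
        gcongr
    _ = _ := by
        rw [← mul_assoc, ← ENNReal.ofReal_mul (by positivity), traceConst]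

end PointwiseBound

section Trace

open scoped Topology

variable {n : ℕ} {β s σ T μ : ℝ} {U H : ℝ → En n → En n → ℂ}

theorem tendsto_lintegral_comp_shear_sub {f : En n × En n → ℂ} (hf : MemLp f 2 volume) (t₀ : ℝ) :
    Tendsto (fun t => ∫⁻ q, ‖f (shear n t q) - f (shear n t₀ q)‖ₑ ^ 2) (𝓝 t₀) (𝓝 0) := by
  let g : ℝ → C(En n × En n, En n × En n) := fun t => ⟨shear n t, (shear n t).continuous⟩
  have hg : Continuous g := by
    refine ContinuousMap.continuous_of_continuous_uncurry _ ?_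
    change Continuous fun p : ℝ × (En n × En n) => (p.2.1, p.2.2 + p.1 • p.2.1)
    fun_prop
  have hgm : ∀ t, MeasurePreserving (g t) (volume : Measure (En n × En n)) volume :=
    fun t => measurePreserving_shear t
  have key := Filter.Tendsto.compMeasurePreservingLp (tendsto_const_nhds (x := hf.toLp f))
    (hg.tendsto t₀) hgm (hgm t₀) ENNReal.ofNat_ne_top
  rw [tendsto_iff_edist_tendsto_0] at key
  have key2 := (ENNReal.continuous_pow 2).tendsto 0 |>.comp key
  simp only [ne_eq, OfNat.ofNat_ne_zero, not_false_eq_true, zero_pow] at key2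
  refine key2.congr fun t => ?_
  rw [Function.comp_apply, Lp.toLp_compMeasurePreserving, Lp.toLp_compMeasurePreserving,
    Lp.edist_toLp_toLp]
  have := eLpNorm_nnreal_pow_eq_lintegral (p := 2) (f := f ∘ g t - f ∘ g t₀)
    (μ := (volume : Measure (En n × En n))) two_ne_zero
  norm_num at this
  rw [this]
  rfl

/-- The representative of `U` along characteristics, weighted so that its `L²` norm is the
`X_β^σ` norm. -/
def weightedRep (n : ℕ) (β σ T : ℝ) (U H : ℝ → En n → En n → ℂ) (t : ℝ) (q : En n × En n) : ℂ :=
  (omegaB n β q.1 (q.2 - t • q.1) ^ σ) • charRep n T U H t q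

theorem ofReal_omegaB_rpow_mul_sq (k ξ : En n) (z : ℂ) :
    ENNReal.ofReal (omegaB n β k ξ ^ (2 * σ) * ‖z‖ ^ 2) = ‖(omegaB n β k ξ ^ σ) • z‖ₑ ^ 2 := by
  have hω : 0 ≤ omegaB n β k ξ := zero_le_one.trans (one_le_omegaB _ _ _ _)
  rw [← ofReal_norm, ← ENNReal.ofReal_pow (norm_nonneg _), norm_smul, mul_pow,
    Real.norm_of_nonneg (Real.rpow_nonneg hω _), mul_comm 2 σ, Real.rpow_mul hω]
  norm_num

theorem weightedRep_shear (t : ℝ) (q : En n × En n) :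
    weightedRep n β σ T U H t (shear n t q) =
      (omegaB n β q.1 q.2 ^ σ) • timeRep n T U H t q.1 q.2 := by
  simp [weightedRep, timeRep, shear_apply]

theorem measurable_weightedRep (hβ : 0 < β) (hU : MeasU n U) (hH : MeasU n H) (t : ℝ) :
    Measurable (weightedRep n β σ T U H t) := by
  have h1 : Measurable fun q : En n × En n => omegaB n β q.1 (q.2 - t • q.1) :=
    ((continuous_omegaB (n := n) hβ).comp (f := fun q : En n × En n =>
      (q.1, q.2 - t • q.1)) (by fun_prop)).measurable
  exact (h1.pow_const σ).smul (measurable_charRep_apply hU hH t)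

theorem Xnorm_timeRep (hβ : 0 < β) (hU : MeasU n U) (hH : MeasU n H) (t : ℝ) :
    Xnorm n β σ (timeRep n T U H t) = ∫⁻ q, ‖weightedRep n β σ T U H t q‖ₑ ^ 2 := by
  rw [Xnorm_eq_lintegral hβ (measurable_timeRep hU hH t),
    ← (measurePreserving_shear (n := n) t).lintegral_comp
      ((measurable_weightedRep hβ hU hH t).enorm.pow_const 2)]
  refine lintegral_congr fun q => ?_
  rw [weightedRep_shear, ofReal_omegaB_rpow_mul_sq]

theorem Xnorm_timeRep_sub_le (hβ : 0 < β) (hU : MeasU n U) (hH : MeasU n H) (t t₀ : ℝ) :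
    Xnorm n β σ (fun k ξ => timeRep n T U H t k ξ - timeRep n T U H t₀ k ξ) ≤
      2 * (∫⁻ q, ‖weightedRep n β σ T U H t q - weightedRep n β σ T U H t₀ q‖ₑ ^ 2) +
      2 * ∫⁻ q, ‖weightedRep n β σ T U H t₀ (shear n t q) -
        weightedRep n β σ T U H t₀ (shear n t₀ q)‖ₑ ^ 2 := by
  have hm : ∀ t, Measurable (weightedRep n β σ T U H t) := measurable_weightedRep hβ hU hH
  have hmd : Measurable fun q =>
      ‖weightedRep n β σ T U H t q - weightedRep n β σ T U H t₀ q‖ₑ ^ 2 :=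
    ((hm t).sub (hm t₀)).enorm.pow_const 2
  have hmd' : Measurable fun q => 2 * ‖weightedRep n β σ T U H t (shear n t q) -
      weightedRep n β σ T U H t₀ (shear n t q)‖ₑ ^ 2 :=
    (hmd.comp (shear n t).measurable).const_mul 2
  rw [Xnorm_eq_lintegral hβ ((measurable_timeRep hU hH t).sub (measurable_timeRep hU hH t₀)),
    ← (measurePreserving_shear (n := n) t).lintegral_comp hmd,
    ← lintegral_const_mul' _ _ ENNReal.ofNat_ne_top, ← lintegral_const_mul' _ _ ENNReal.ofNat_ne_top,
    ← lintegral_add_left hmd']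
  refine lintegral_mono fun q => ?_
  rw [ofReal_omegaB_rpow_mul_sq, smul_sub, ← weightedRep_shear, ← weightedRep_shear]
  refine le_trans (pow_le_pow_left' ?_ 2) (add_sq_le_two_mul _ _)
  rw [← sub_add_sub_cancel _ (weightedRep n β σ T U H t₀ (shear n t q))]
  exact enorm_add_le _ _

theorem continuous_weightedRep (hT : 0 < T) (hβ : 0 < β) {q : En n × En n}
    (hUi : Integrable fun t => alongChar n T U (t, q))
    (hHi : Integrable fun t => alongChar n T H (t, q)) :
    Continuous fun t => weightedRep n β σ T U H t q := by
  have h1 : Continuous fun t : ℝ => omegaB n β q.1 (q.2 - t • q.1) :=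
    (continuous_omegaB (n := n) hβ).comp (f := fun t : ℝ => (q.1, q.2 - t • q.1)) (by fun_prop)
  exact (h1.rpow_const fun t => Or.inl
    (zero_lt_one.trans_le (one_le_omegaB _ _ _ _)).ne').smul (continuous_timePrimitive hT hUi hHi)

/-- If `‖F t q‖²` is dominated uniformly in time by an integrable function and `F` is continuous
in time, then `F` is continuous with values in `L²`. -/
theorem tendsto_lintegral_enorm_sub_sq {α : Type*} [MeasurableSpace α] {ν : Measure α}
    {F : ℝ → α → ℂ} (hF : ∀ t, Measurable (F t)) (hc : ∀ᵐ q ∂ν, Continuous fun t => F t q)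
    {b : α → ℝ≥0∞} (hb : ∫⁻ q, b q ∂ν ≠ ⊤) {S : Set ℝ} {t₀ : ℝ} (ht₀ : t₀ ∈ S)
    (hbound : ∀ᵐ q ∂ν, ∀ t ∈ S, ‖F t q‖ₑ ^ 2 ≤ b q) :
    Tendsto (fun t => ∫⁻ q, ‖F t q - F t₀ q‖ₑ ^ 2 ∂ν) (𝓝[S] t₀) (𝓝 0) := by
  have key := tendsto_lintegral_filter_of_dominated_convergence (μ := ν) (l := 𝓝[S] t₀)
    (F := fun t q => ‖F t q - F t₀ q‖ₑ ^ 2) (f := fun _ => 0) (fun q => 4 * b q)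
    (Eventually.of_forall fun t => ((hF t).sub (hF t₀)).enorm.pow_const 2)
    (by
      filter_upwards [self_mem_nhdsWithin] with t ht
      filter_upwards [hbound] with q hq
      calc ‖F t q - F t₀ q‖ₑ ^ 2 ≤ (‖F t q‖ₑ + ‖F t₀ q‖ₑ) ^ 2 :=
            pow_le_pow_left' (enorm_sub_le) 2
        _ ≤ 2 * ‖F t q‖ₑ ^ 2 + 2 * ‖F t₀ q‖ₑ ^ 2 := add_sq_le_two_mul _ _
        _ ≤ 2 * b q + 2 * b q := by gcongr; exacts [hq t ht, hq t₀ ht₀]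
        _ = 4 * b q := by rw [← add_mul]; norm_num)
    (by
      rw [lintegral_const_mul' _ _ ENNReal.ofNat_ne_top]
      exact ENNReal.mul_ne_top ENNReal.ofNat_ne_top hb)
    (by
      filter_upwards [hc] with q hq
      have h1 : Continuous fun t => ‖F t q - F t₀ q‖ₑ ^ 2 :=
        (ENNReal.continuous_pow 2).comp (hq.sub continuous_const).enorm
      simpa using (h1.tendsto t₀).mono_left nhdsWithin_le_nhds)
  simpa using key

theorem traceConst_pos {δ : ℝ} (hδ : 0 < δ) : 0 < traceConst β s μ δ := by
  have := windowScale_pos (β := β) hδ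
  rw [traceConst]
  positivity

theorem ae_enorm_weightedRep_sq_le (hT : 0 < T) (hβ : β ∈ Ioc (0 : ℝ) 2) (hs : 0 ≤ s)
    (hμ : μ ∈ Ioc (1 / 2 : ℝ) 1) (hU : MeasU n U) (hH : MeasU n H)
    (h : IsFTransportDeriv n T U H) (hUf : L2X n β s T μ U < ⊤) (hHf : L2X n β s T μ H < ⊤)
    {δ : ℝ} (hδ : 0 < δ) :
    ∀ᵐ q : En n × En n, ∀ t ∈ Icc δ T, ‖weightedRep n β (s + 1 / 2) T U H t q‖ₑ ^ 2 ≤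
      ENNReal.ofReal (traceConst β s μ δ) *
        (charEnergy n β (s + 1) T μ U q + charEnergy n β s T μ H q) := by
  filter_upwards [ae_integrable_alongChar hβ.1 hs hμ.1 hU hUf,
    ae_integrable_alongChar hβ.1 hs hμ.1 hH hHf,
    ae_ae_alongChar_eq_charRep (ae_alongChar_eq_charRep hT hβ.1 hs hμ.1 hU hH h hUf hHf)]
    with q h1 h2 h3 t ht
  rw [weightedRep, ← ofReal_omegaB_rpow_mul_sq]
  exact ofReal_omegaB_mul_charRep_le hT hβ hs hμ.2 hH h1 h2 h3 hδ ht

theorem lintegral_charEnergy_add (hβ : 0 < β) (hU : MeasU n U) (hH : MeasU n H) (c : ℝ) :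
    ∫⁻ q, ENNReal.ofReal c * (charEnergy n β (s + 1) T μ U q + charEnergy n β s T μ H q) =
      ENNReal.ofReal c * (L2X n β (s + 1) T μ U + L2X n β s T μ H) := by
  rw [lintegral_const_mul' _ _ ENNReal.ofReal_ne_top,
    lintegral_add_left (measurable_charEnergy hβ hU), lintegral_charEnergy hβ hU,
    lintegral_charEnergy hβ hH]

theorem Xnorm_timeRep_le (hT : 0 < T) (hβ : β ∈ Ioc (0 : ℝ) 2) (hs : 0 ≤ s)
    (hμ : μ ∈ Ioc (1 / 2 : ℝ) 1) (hU : MeasU n U) (hH : MeasU n H)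
    (h : IsFTransportDeriv n T U H) (hUf : L2X n β s T μ U < ⊤) (hHf : L2X n β s T μ H < ⊤)
    {δ t : ℝ} (hδ : 0 < δ) (ht : t ∈ Icc δ T) :
    Xnorm n β (s + 1 / 2) (timeRep n T U H t) ≤
      ENNReal.ofReal (traceConst β s μ δ) * (L2X n β (s + 1) T μ U + L2X n β s T μ H) := by
  rw [Xnorm_timeRep hβ.1 hU hH, ← lintegral_charEnergy_add hβ.1 hU hH]
  refine lintegral_mono_ae ?_
  filter_upwards [ae_enorm_weightedRep_sq_le hT hβ hs hμ hU hH h hUf hHf hδ] with q hq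
  exact hq t ht

theorem tendsto_Xnorm_timeRep_sub (hT : 0 < T) (hβ : β ∈ Ioc (0 : ℝ) 2) (hs : 0 ≤ s)
    (hμ : μ ∈ Ioc (1 / 2 : ℝ) 1) (hU : MeasU n U) (hH : MeasU n H)
    (h : IsFTransportDeriv n T U H) (hUf : L2X n β s T μ U < ⊤) (hHf : L2X n β s T μ H < ⊤)
    (hUf' : L2X n β (s + 1) T μ U < ⊤) {t₀ : ℝ} (ht₀ : t₀ ∈ Ioc 0 T) :
    Tendsto (fun t => Xnorm n β (s + 1 / 2)
      (fun k ξ => timeRep n T U H t k ξ - timeRep n T U H t₀ k ξ)) (𝓝[Ioc 0 T] t₀) (𝓝 0) := by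
  have hδ : 0 < t₀ / 2 := half_pos ht₀.1
  have hmem : t₀ ∈ Icc (t₀ / 2) T := ⟨by linarith, ht₀.2⟩
  have hnhds : 𝓝[Ioc 0 T] t₀ ≤ 𝓝[Icc (t₀ / 2) T] t₀ := by
    refine nhdsWithin_le_of_mem ?_
    filter_upwards [self_mem_nhdsWithin,
      mem_nhdsWithin_of_mem_nhds (Ioi_mem_nhds (half_lt_self ht₀.1))] with t h1 h2
    exact ⟨le_of_lt h2, h1.2⟩
  have hbound := ae_enorm_weightedRep_sq_le hT hβ hs hμ hU hH h hUf hHf hδ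
  have hfin : ENNReal.ofReal (traceConst β s μ (t₀ / 2)) *
      (L2X n β (s + 1) T μ U + L2X n β s T μ H) ≠ ⊤ :=
    ENNReal.mul_ne_top ENNReal.ofReal_ne_top (ENNReal.add_ne_top.2 ⟨hUf'.ne, hHf.ne⟩)
  have h1 := tendsto_lintegral_enorm_sub_sq
    (measurable_weightedRep (σ := s + 1 / 2) (T := T) hβ.1 hU hH)
    (by
      filter_upwards [ae_integrable_alongChar hβ.1 hs hμ.1 hU hUf,
        ae_integrable_alongChar hβ.1 hs hμ.1 hH hHf] with q hq1 hq2
      exact continuous_weightedRep hT hβ.1 hq1 hq2)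
    (by rwa [lintegral_charEnergy_add hβ.1 hU hH]) hmem hbound
  have hL2 : MemLp (weightedRep n β (s + 1 / 2) T U H t₀) 2 volume := by
    refine ⟨(measurable_weightedRep hβ.1 hU hH t₀).aestronglyMeasurable, ?_⟩
    rw [eLpNorm_lt_top_iff_lintegral_rpow_enorm_lt_top two_ne_zero ENNReal.ofNat_ne_top]
    simp only [ENNReal.toReal_ofNat, ENNReal.rpow_ofNat]
    rw [← Xnorm_timeRep hβ.1 hU hH]
    exact (Xnorm_timeRep_le hT hβ hs hμ hU hH h hUf hHf hδ hmem).trans_lt hfin.lt_top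
  have h2 := (tendsto_lintegral_comp_shear_sub hL2 t₀).mono_left
    (nhdsWithin_le_nhds (s := Ioc 0 T))
  have h3 := (ENNReal.Tendsto.const_mul (a := 2) (h1.mono_left hnhds)
    (Or.inr ENNReal.ofNat_ne_top)).add (ENNReal.Tendsto.const_mul (a := 2) h2
    (Or.inr ENNReal.ofNat_ne_top))
  rw [mul_zero, add_zero] at h3
  exact tendsto_of_tendsto_of_tendsto_of_le_of_le tendsto_const_nhds h3 (fun _ => zero_le)
    fun t => Xnorm_timeRep_sub_le hβ.1 hU hH t t₀

end Trace

theorem stmt17 (n : ℕ) (hn : 1 ≤ n) (T μ β s : ℝ) (hT : 0 < T)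
    (hμ : μ ∈ Ioc (1/2 : ℝ) 1) (hβ : β ∈ Ioc (0:ℝ) 2) (hs : 0 ≤ s) :
    ∀ δ ∈ Ioo (0:ℝ) T, ∃ C : ℝ, 0 < C ∧
      ∀ U H : ℝ → En n → En n → ℂ, MeasU n U → MeasU n H →
        -- `u ∈ T_μ((0,T);X_β^s) ∩ L²_μ((0,T);X_β^{s+1})`
        IsFTransportDeriv n T U H → L2X n β s T μ U < ⊤ → L2X n β s T μ H < ⊤ →
        L2X n β (s + 1) T μ U < ⊤ →
        ∃ V : ℝ → En n → En n → ℂ,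
          -- `V` is a representative of `U`
          (∀ᵐ t ∂(volume.restrict (Ioo 0 T)), ∀ᵐ (k : En n) ∂(volume : Measure (En n)),
            ∀ᵐ (ξ : En n) ∂(volume : Measure (En n)), V t k ξ = U t k ξ) ∧
          -- which is continuous from `(0,T]` to `X_β^{s+1/2}`
          (∀ t₀ ∈ Ioc (0:ℝ) T, Xnorm n β (s + 1/2) (V t₀) < ⊤ ∧
            Tendsto (fun t : ℝ => Xnorm n β (s + 1/2) (fun k ξ => V t k ξ - V t₀ k ξ))
              (nhdsWithin t₀ (Ioc 0 T)) (nhds 0)) ∧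
          -- with a uniform bound on `[δ,T]` by the norm of `u`
          (∀ t ∈ Icc δ T, (Xnorm n β (s + 1/2) (V t)) ^ ((1:ℝ)/2)
            ≤ ENNReal.ofReal C *
              ((L2X n β s T μ U) ^ ((1:ℝ)/2) + (L2X n β s T μ H) ^ ((1:ℝ)/2)
                + (L2X n β (s + 1) T μ U) ^ ((1:ℝ)/2))) := by
  intro δ hδ
  refine ⟨traceConst β s μ δ ^ ((1 : ℝ) / 2), Real.rpow_pos_of_pos (traceConst_pos hδ.1) _, ?_⟩
  intro U H hU hH h hUf hHf hUf'
  refine ⟨timeRep n T U H,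
    ae_timeRep_eq (ae_alongChar_eq_charRep hT hβ.1 hs hμ.1 hU hH h hUf hHf), ?_, ?_⟩
  · intro t₀ ht₀
    refine ⟨?_, tendsto_Xnorm_timeRep_sub hT hβ hs hμ hU hH h hUf hHf hUf' ht₀⟩
    refine (Xnorm_timeRep_le hT hβ hs hμ hU hH h hUf hHf ht₀.1 ⟨le_rfl, ht₀.2⟩).trans_lt ?_
    exact ENNReal.mul_lt_top ENNReal.ofReal_lt_top (ENNReal.add_lt_top.2 ⟨hUf', hHf⟩)
  · intro t ht
    rw [← ENNReal.ofReal_rpow_of_pos (traceConst_pos hδ.1)]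
    calc _ ≤ (ENNReal.ofReal (traceConst β s μ δ) *
          (L2X n β (s + 1) T μ U + L2X n β s T μ H)) ^ ((1 : ℝ) / 2) :=
          ENNReal.rpow_le_rpow (Xnorm_timeRep_le hT hβ hs hμ hU hH h hUf hHf hδ.1 ht)
            (by norm_num)
      _ = ENNReal.ofReal (traceConst β s μ δ) ^ ((1 : ℝ) / 2) *
          (L2X n β (s + 1) T μ U + L2X n β s T μ H) ^ ((1 : ℝ) / 2) :=
          ENNReal.mul_rpow_of_nonneg _ _ (by norm_num)
      _ ≤ _ := by
          gcongr
          refine (ENNReal.rpow_add_le_add_rpow _ _ (by norm_num) (by norm_num)).trans ?_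
          rw [add_comm (_ ^ _)]
          gcongr
          exact le_add_of_nonneg_left (by positivity)
end
end

section
/- Let T > 0, μ ∈ (1/2,1] and r ≥ 0. If u ∈ L²_μ((0,T); L²(ℝ^{2n})), its distributional transport derivative ∂_t u + v·∇_x u belongs to L²_μ((0,T); L²(ℝ^{2n})), and u ∈ L²_μ((0,T); H_v^r(ℝ^{2n})), then u ∈ L²_μ((0,T); H_x^{r/(r+1)}(ℝ^{2n})), i.e. ∫₀ᵀ t^{2−2μ} ∫_{ℝ^{2n}} (1+|k|²)^{r/(r+1)} |û(t,k,ξ)|² dk dξ dt < ∞. -/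
open MeasureTheory Set Filter
open scoped ENNReal

noncomputable section

open scoped ContDiff Convolution in
/-- The primitive in the first variable of a smooth compactly supported function is smooth. -/
theorem contDiff_integral_Iic {P : Type*} [NormedAddCommGroup P] [NormedSpace ℝ P]
    {θ : ℝ × P → ℝ} (hθ : ContDiff ℝ ∞ θ) (hc : HasCompactSupport θ) :
    ContDiff ℝ ∞ (fun p : ℝ × P => ∫ x in Iic p.1, θ (x, p.2)) := by
  have hk : IsCompact (Prod.fst '' tsupport θ) := hc.isCompact.image continuous_fst
  have hf : LocallyIntegrable ((Ici (0 : ℝ)).indicator (1 : ℝ → ℝ)) volume :=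
    (locallyIntegrable_const (1 : ℝ)).indicator measurableSet_Ici
  have key := contDiffOn_convolution_right_with_param (𝕜 := ℝ) (n := (⊤ : ℕ∞))
    (ContinuousLinearMap.mul ℝ ℝ) (g := fun (q : P) (x : ℝ) => θ (x, q)) (s := univ)
    isOpen_univ hk
    (fun q x _ hx => by
      by_contra h
      exact hx ⟨(x, q), subset_tsupport _ h, rfl⟩) hf
    (by
      refine ContDiff.contDiffOn ?_
      exact hθ.comp (contDiff_snd.prodMk contDiff_fst))
  rw [univ_prod_univ, contDiffOn_univ] at key
  convert key.comp (contDiff_snd.prodMk contDiff_fst : ContDiff ℝ _ fun p : ℝ × P => (p.2, p.1))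
    using 2 with p
  rw [Function.comp_apply, MeasureTheory.convolution, ← integral_indicator measurableSet_Iic,
    ← integral_sub_left_eq_self _ volume p.1]
  refine integral_congr_ae (Eventually.of_forall fun x => ?_)
  by_cases hx : 0 ≤ x <;> simp [indicator, hx]

/-- The backward integral of `θ` along the first variable, over a window of length `τ`. -/
def timeWindow {P : Type*} (τ : P → ℝ) (θ : ℝ × P → ℝ) (p : ℝ × P) : ℝ :=
  ∫ σ in (0 : ℝ)..τ p.2, θ (p.1 - σ, p.2)

theorem timeWindow_eq {P : Type*} {τ : P → ℝ} {θ : ℝ × P → ℝ} (p : ℝ × P) :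
    timeWindow τ θ p = ∫ x in (p.1 - τ p.2)..p.1, θ (x, p.2) := by
  have := intervalIntegral.integral_comp_sub_left (a := 0) (b := τ p.2)
    (fun x => θ (x, p.2)) p.1
  simpa [timeWindow] using this

theorem exists_ne_zero_of_timeWindow_ne_zero {P : Type*} {τ : P → ℝ} {θ : ℝ × P → ℝ}
    (hτ0 : ∀ q, 0 ≤ τ q) {p : ℝ × P}
    (h : timeWindow τ θ p ≠ 0) : ∃ σ ∈ Icc 0 (τ p.2), θ (p.1 - σ, p.2) ≠ 0 := by
  by_contra! h0
  refine h ?_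
  refine (intervalIntegral.integral_congr fun σ hσ => h0 σ ?_).trans
    intervalIntegral.integral_zero
  rwa [uIcc_of_le (hτ0 _)] at hσ

theorem hasCompactSupport_timeWindow {P : Type*} [TopologicalSpace P] [R1Space P] {τ : P → ℝ}
    {θ : ℝ × P → ℝ} (hτ : Continuous τ) (hτ0 : ∀ q, 0 ≤ τ q)
    (hc : HasCompactSupport θ) : HasCompactSupport (timeWindow τ θ) := by
  obtain ⟨M, hM⟩ := (hc.isCompact.image continuous_snd).bddAbove_image hτ.continuousOn
  refine HasCompactSupport.intro ((hc.isCompact.prod (isCompact_Icc (a := 0) (b := M))).image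
    (f := fun z : (ℝ × P) × ℝ => (z.1.1 + z.2, z.1.2)) (by fun_prop)) fun p hp => ?_
  by_contra h
  obtain ⟨σ, hσ, hne⟩ := exists_ne_zero_of_timeWindow_ne_zero hτ0 h
  have hmem := subset_tsupport θ hne
  refine hp ⟨((p.1 - σ, p.2), σ), ⟨hmem, hσ.1, hσ.2.trans ?_⟩, by simp⟩
  exact hM ⟨p.2, ⟨_, hmem, rfl⟩, rfl⟩

theorem hasDerivAt_timeWindow {P : Type*} [TopologicalSpace P] {τ : P → ℝ} {θ : ℝ × P → ℝ}
    (hθ : Continuous θ) (t : ℝ) (q : P) :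
    HasDerivAt (fun s => timeWindow τ θ (s, q)) (θ (t, q) - θ (t - τ q, q)) t := by
  have hcont : Continuous fun x => θ (x, q) := by fun_prop
  have hprim (a : ℝ) : HasDerivAt (fun s => ∫ x in (0 : ℝ)..s, θ (x, q)) (θ (a, q)) a :=
    intervalIntegral.integral_hasDerivAt_right (hcont.intervalIntegrable _ _)
      (hcont.stronglyMeasurableAtFilter _ _) hcont.continuousAt
  have h2 : HasDerivAt (fun s => ∫ x in (0 : ℝ)..(s - τ q), θ (x, q)) (θ (t - τ q, q)) t := by
    simpa using (hprim (t - τ q)).comp_sub_const t (τ q)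
  refine ((hprim t).sub h2).congr_of_eventuallyEq (Eventually.of_forall fun s => ?_)
  simp only [timeWindow_eq, Pi.sub_apply]
  rw [intervalIntegral.integral_interval_sub_left (hcont.intervalIntegrable _ _)
      (hcont.intervalIntegrable _ _)]

section timeWindow

open scoped ContDiff

variable {P : Type*} [NormedAddCommGroup P] [NormedSpace ℝ P] {τ : P → ℝ} {θ : ℝ × P → ℝ}

theorem contDiff_timeWindow (hτ : ContDiff ℝ ∞ τ) (hθ : ContDiff ℝ ∞ θ)
    (hc : HasCompactSupport θ) : ContDiff ℝ ∞ (timeWindow τ θ) := by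
  have h := contDiff_integral_Iic hθ hc
  have h2 := h.comp ((contDiff_fst.sub (hτ.comp contDiff_snd)).prodMk contDiff_snd :
    ContDiff ℝ ∞ fun p : ℝ × P => (p.1 - τ p.2, p.2))
  convert h.sub h2 using 2 with p
  have hi : Integrable (fun x => θ (x, p.2)) := by
    refine Continuous.integrable_of_hasCompactSupport (by fun_prop) ?_
    refine HasCompactSupport.intro (hc.isCompact.image continuous_fst) fun x hx => ?_
    by_contra h
    exact hx ⟨(x, p.2), subset_tsupport _ h, rfl⟩
  rw [timeWindow_eq, Function.comp_apply]
  exact (intervalIntegral.integral_Iic_sub_Iic hi.integrableOn hi.integrableOn).symm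

end timeWindow

section shift

variable {P : Type*}

/-- The time shift `(t, q) ↦ (t + τ q, q)`. -/
def timeShift [TopologicalSpace P] (τ : P → ℝ) (hτ : Continuous τ) : (ℝ × P) ≃ₜ (ℝ × P) where
  toFun p := (p.1 + τ p.2, p.2)
  invFun p := (p.1 - τ p.2, p.2)
  left_inv p := by simp
  right_inv p := by simp
  continuous_toFun := by fun_prop
  continuous_invFun := by fun_prop

theorem timeShift_apply [TopologicalSpace P] (τ : P → ℝ) (hτ : Continuous τ) (p : ℝ × P) :
    timeShift τ hτ p = (p.1 + τ p.2, p.2) :=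
  rfl

theorem measurePreserving_timeShift [TopologicalSpace P] [MeasureSpace P] [BorelSpace P]
    [SecondCountableTopology P] [SFinite (volume : Measure P)] (τ : P → ℝ) (hτ : Continuous τ) :
    MeasurePreserving (timeShift τ hτ) := by
  have h : MeasurePreserving (fun p : P × ℝ => (p.1, p.2 + τ p.1))
      ((volume : Measure P).prod (volume : Measure ℝ)) (volume.prod volume) :=
    (MeasurePreserving.id volume).skew_product (g := fun q t => t + τ q)
      (by have := hτ.measurable; fun_prop)
      (Eventually.of_forall fun q => (measurePreserving_add_right volume (τ q)).map_eq)
  exact (Measure.measurePreserving_swap.comp h).comp Measure.measurePreserving_swap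

/-- The time shift of `ℝ × P` by an additional parameter. -/
def timeShiftProd [TopologicalSpace P] : ((ℝ × P) × ℝ) ≃ₜ ((ℝ × P) × ℝ) where
  toFun z := ((z.1.1 + z.2, z.1.2), z.2)
  invFun z := ((z.1.1 - z.2, z.1.2), z.2)
  left_inv p := by simp
  right_inv p := by simp
  continuous_toFun := by fun_prop
  continuous_invFun := by fun_prop

theorem timeShiftProd_apply [TopologicalSpace P] (z : (ℝ × P) × ℝ) :
    timeShiftProd z = ((z.1.1 + z.2, z.1.2), z.2) :=
  rfl

theorem measurePreserving_timeShiftProd [TopologicalSpace P] [MeasureSpace P] [BorelSpace P]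
    [SecondCountableTopology P] [SFinite (volume : Measure P)] :
    MeasurePreserving (timeShiftProd (P := P)) := by
  have h : MeasurePreserving (fun p : ℝ × (ℝ × P) => (p.1, (p.2.1 + p.1, p.2.2)))
      ((volume : Measure ℝ).prod (volume : Measure (ℝ × P))) (volume.prod volume) :=
    (MeasurePreserving.id volume).skew_product (g := fun (σ : ℝ) (p : ℝ × P) => (p.1 + σ, p.2))
      (by fun_prop)
      (Eventually.of_forall fun σ =>
        ((measurePreserving_add_right volume σ).prod (MeasurePreserving.id volume)).map_eq)
  exact (Measure.measurePreserving_swap.comp h).comp Measure.measurePreserving_swap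

end shift

theorem LocallyIntegrable.comp_homeomorph {X E : Type*} [TopologicalSpace X] [MeasurableSpace X]
    [BorelSpace X] [NormedAddCommGroup E] [LocallyCompactSpace X] {μ : Measure X} {f : X → E}
    (hf : LocallyIntegrable f μ) (e : X ≃ₜ X) (he : MeasurePreserving e μ μ) :
    LocallyIntegrable (f ∘ e) μ := by
  rw [locallyIntegrable_iff]
  intro K hK
  have := (he.integrableOn_comp_preimage e.measurableEmbedding).2
    (hf.integrableOn_isCompact (hK.image e.continuous))
  rwa [preimage_image_eq _ e.injective] at this

section duality

open scoped ContDiff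

variable {P : Type*} [NormedAddCommGroup P] [NormedSpace ℝ P] [FiniteDimensional ℝ P]
  [MeasureSpace P] [BorelSpace P] {τ : P → ℝ}

theorem integrable_window_smul (hτ : Continuous τ) {G : ℝ × P → ℂ}
    (hG : LocallyIntegrable G) {θ : ℝ × P → ℝ} (hθ : Measurable θ) {C : ℝ}
    (hC : ∀ p, ‖θ p‖ ≤ C) {K : Set (ℝ × P)} (hK : IsCompact K) (hθK : ∀ p, p ∉ K → θ p = 0) :
    Integrable (fun z : (ℝ × P) × ℝ => {z : (ℝ × P) × ℝ | z.2 ∈ Ioc 0 (τ z.1.2)}.indicator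
      (fun z => θ (z.1.1 - z.2, z.1.2)) z • G z.1) := by
  have : SecondCountableTopology P := secondCountable_of_proper
  obtain ⟨M, hM⟩ := (hK.image continuous_snd).bddAbove_image hτ.continuousOn
  set K' := (fun z : (ℝ × P) × ℝ => (z.1.1 + z.2, z.1.2)) '' (K ×ˢ Icc 0 M) with hK'_def
  have hK' : IsCompact K' := (hK.prod isCompact_Icc).image (by fun_prop)
  have h1 : Integrable (K'.indicator G) :=
    (integrable_indicator_iff hK'.measurableSet).2 (hG.integrableOn_isCompact hK')
  have h2 : Integrable ((Icc 0 M).indicator (1 : ℝ → ℂ)) :=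
    (integrable_indicator_iff measurableSet_Icc).2
      (integrableOn_const (by simp) (by simp))
  have hS : MeasurableSet {z : (ℝ × P) × ℝ | z.2 ∈ Ioc 0 (τ z.1.2)} := by
    have := hτ.measurable
    exact (measurableSet_lt measurable_const measurable_snd).inter
      (measurableSet_le measurable_snd (by fun_prop))
  have h3 := (h1.mul_prod h2).bdd_smul (φ := {z : (ℝ × P) × ℝ | z.2 ∈ Ioc 0 (τ z.1.2)}.indicator
      (fun z => θ (z.1.1 - z.2, z.1.2))) C
    (Measurable.aestronglyMeasurable (Measurable.indicator (by fun_prop) hS))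
    (Eventually.of_forall fun z => (norm_indicator_le_norm_self _ _).trans (hC _))
  refine h3.congr (Eventually.of_forall fun z => ?_)
  by_cases hz : z.2 ∈ Ioc 0 (τ z.1.2)
  · by_cases hne : θ (z.1.1 - z.2, z.1.2) = 0
    · simp [indicator, hne]
    · have hmem : (z.1.1 - z.2, z.1.2) ∈ K := by
        by_contra h
        exact hne (hθK _ h)
      have hzM : z.2 ∈ Icc 0 M := ⟨hz.1.le, hz.2.trans (hM ⟨_, ⟨_, hmem, rfl⟩, rfl⟩)⟩
      have hzK : z.1 ∈ K' := ⟨((z.1.1 - z.2, z.1.2), z.2), ⟨hmem, hzM⟩, by simp⟩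
      simp [hzM, hzK]
  · have hz' : z ∉ {z : (ℝ × P) × ℝ | z.2 ∈ Ioc 0 (τ z.1.2)} := hz
    simp only [Pi.smul_apply', indicator_of_notMem hz', zero_smul]

theorem ae_shift_eq_of_forall_integral [SFinite (volume : Measure P)]
    (hτ : ContDiff ℝ ∞ τ) (hτ0 : ∀ q, 0 ≤ τ q) {V G : ℝ × P → ℂ}
    (hV : LocallyIntegrable V) (hG : LocallyIntegrable G) {Ω : Set (ℝ × P)} (hΩ : IsOpen Ω)
    (h : ∀ θ : ℝ × P → ℝ, ContDiff ℝ ∞ θ → HasCompactSupport θ → tsupport θ ⊆ Ω →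
      -∫ p, (θ p - θ (p.1 - τ p.2, p.2)) • V p = ∫ p, timeWindow τ θ p • G p) :
    ∀ᵐ p : ℝ × P, p ∈ Ω →
      V (p.1 + τ p.2, p.2) - V p = ∫ σ in Ioc 0 (τ p.2), G (p.1 + σ, p.2) := by
  have : SecondCountableTopology P := secondCountable_of_proper
  have hshift := measurePreserving_timeShift τ hτ.continuous
  have hVs : LocallyIntegrable (fun p : ℝ × P => V (p.1 + τ p.2, p.2)) :=
    LocallyIntegrable.comp_homeomorph hV (timeShift τ hτ.continuous) hshift
  have hF' {θ : ℝ × P → ℝ} (hθ : Measurable θ) {C : ℝ}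
      (hC : ∀ p, ‖θ p‖ ≤ C) {K : Set (ℝ × P)} (hK : IsCompact K) (hθK : ∀ p, p ∉ K → θ p = 0) :
      Integrable (fun z : (ℝ × P) × ℝ =>
        θ z.1 • (Ioc 0 (τ z.1.2)).indicator (fun σ => G (z.1.1 + σ, z.1.2)) z.2) := by
    refine (measurePreserving_timeShiftProd.integrable_comp_of_integrable
      (integrable_window_smul hτ.continuous hG hθ hC hK hθK)).congr
      (Eventually.of_forall fun z => ?_)
    by_cases hz : 0 < z.2 ∧ z.2 ≤ τ z.1.2
    · simp [indicator, hz.1, hz.2, timeShiftProd_apply]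
    · have h1 : timeShiftProd z ∉ {z : (ℝ × P) × ℝ | z.2 ∈ Ioc 0 (τ z.1.2)} := hz
      have h2 : z.2 ∉ Ioc 0 (τ z.1.2) := hz
      simp only [Function.comp_apply, indicator_of_notMem h1, indicator_of_notMem h2, zero_smul,
        smul_zero]
  have hW : LocallyIntegrable
      (fun p : ℝ × P => ∫ σ in Ioc 0 (τ p.2), G (p.1 + σ, p.2)) := by
    rw [locallyIntegrable_iff]
    intro K hK
    rw [← integrable_indicator_iff hK.measurableSet]
    have := (hF' (θ := K.indicator 1) (measurable_one.indicator hK.measurableSet) (C := 1)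
      (fun p => (norm_indicator_le_norm_self _ _).trans (by simp)) hK
      (fun p hp => by simp [hp])).integral_prod_left
    refine this.congr (Eventually.of_forall fun p => ?_)
    by_cases hp : p ∈ K <;> simp [hp, integral_indicator]
  have key := hΩ.ae_eq_zero_of_integral_contDiff_smul_eq_zero (μ := volume)
    (((hVs.sub hV).sub hW).locallyIntegrableOn Ω) fun θ hθ hc hs => ?_
  · filter_upwards [key] with p hp hpΩ
    exact sub_eq_zero.1 (hp hpΩ)
  · obtain ⟨C, hC⟩ := hc.exists_bound_of_continuous hθ.continuous
    have hθK (p : ℝ × P) (hp : p ∉ tsupport θ) : θ p = 0 := image_eq_zero_of_notMem_tsupport hp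
    have i1 : Integrable fun p => θ p • V (p.1 + τ p.2, p.2) :=
      hVs.integrable_smul_left_of_hasCompactSupport hθ.continuous hc
    have i2 : Integrable fun p => θ p • V p :=
      hV.integrable_smul_left_of_hasCompactSupport hθ.continuous hc
    have i3 : Integrable fun p : ℝ × P => θ p • ∫ σ in Ioc 0 (τ p.2), G (p.1 + σ, p.2) :=
      hW.integrable_smul_left_of_hasCompactSupport hθ.continuous hc
    have i4 : Integrable fun p => θ (p.1 - τ p.2, p.2) • V p := by
      rw [← hshift.integrable_comp_emb (timeShift τ hτ.continuous).measurableEmbedding]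
      refine i1.congr (Eventually.of_forall fun p => ?_)
      simp [timeShift_apply]
    have e4 : ∫ p, θ (p.1 - τ p.2, p.2) • V p = ∫ p, θ p • V (p.1 + τ p.2, p.2) := by
      rw [← hshift.integral_comp (timeShift τ hτ.continuous).measurableEmbedding]
      simp [timeShift_apply]
    have e3 : ∫ p, timeWindow τ θ p • G p
        = ∫ p : ℝ × P, θ p • ∫ σ in Ioc 0 (τ p.2), G (p.1 + σ, p.2) := by
      have j1 := integral_prod _
        (integrable_window_smul hτ.continuous hG hθ.continuous.measurable hC hc.isCompact hθK)
      have j2 := integral_prod _ (hF' hθ.continuous.measurable hC hc.isCompact hθK)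
      rw [← Measure.volume_eq_prod] at j1 j2
      calc _ = _ := ?_
        _ = _ := j1.symm
        _ = _ := (measurePreserving_timeShiftProd.integral_comp
          timeShiftProd.measurableEmbedding _).symm
        _ = _ := ?_
        _ = _ := j2
        _ = _ := ?_
      · refine integral_congr_ae (Eventually.of_forall fun p => ?_)
        simp only
        rw [integral_smul_const, timeWindow, intervalIntegral.integral_of_le (hτ0 _),
          ← integral_indicator measurableSet_Ioc]
        rfl
      · refine integral_congr_ae (Eventually.of_forall fun z => ?_)
        by_cases hz : 0 < z.2 ∧ z.2 ≤ τ z.1.2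
        · simp [indicator, hz.1, hz.2, timeShiftProd_apply]
        · simp only [indicator, timeShiftProd_apply,
            mem_ofPred_eq, mem_Ioc, if_neg hz, zero_smul, smul_zero]
      · refine integral_congr_ae (Eventually.of_forall fun p => ?_)
        simp only
        rw [integral_smul, integral_indicator measurableSet_Ioc]
    have hmain := h θ hθ hc hs
    simp only [sub_smul] at hmain
    rw [integral_sub i2 i4, e4, e3] at hmain
    simp only [Pi.sub_apply, smul_sub]
    have e := integral_sub (i1.sub i2) i3
    simp only [Pi.sub_apply] at e
    rw [e, integral_sub i1 i2, ← hmain]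
    ring

end duality

section kinetic

open scoped ContDiff

variable {n : ℕ}

/-- The shear `(t, k, η) ↦ (t, k, η - t k)` straightening the kinetic transport operator. -/
def kineticShear (n : ℕ) : (ℝ × (En n × En n)) ≃ₜ (ℝ × (En n × En n)) where
  toFun p := (p.1, p.2.1, p.2.2 - p.1 • p.2.1)
  invFun p := (p.1, p.2.1, p.2.2 + p.1 • p.2.1)
  left_inv p := by simp
  right_inv p := by simp
  continuous_toFun := by fun_prop
  continuous_invFun := by fun_prop

theorem kineticShear_apply (p : ℝ × (En n × En n)) :
    kineticShear n p = (p.1, p.2.1, p.2.2 - p.1 • p.2.1) :=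
  rfl

theorem kineticShear_symm_apply (p : ℝ × (En n × En n)) :
    (kineticShear n).symm p = (p.1, p.2.1, p.2.2 + p.1 • p.2.1) :=
  rfl

theorem measurePreserving_kineticShear : MeasurePreserving (kineticShear n) := by
  refine (MeasurePreserving.id volume).skew_product
    (g := fun (t : ℝ) (q : En n × En n) => (q.1, q.2 - t • q.1)) (by fun_prop)
    (Eventually.of_forall fun t => MeasurePreserving.map_eq ?_)
  exact (MeasurePreserving.id volume).skew_product
    (g := fun (k : En n) (η : En n) => η - t • k) (by fun_prop)
    (Eventually.of_forall fun k => (measurePreserving_sub_right volume (t • k)).map_eq)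

/-- The extension by zero, outside the time interval `(0, T)`, of a function of `(t, k, ξ)`. -/
def slabExt (T : ℝ) (U : ℝ → En n → En n → ℂ) : ℝ × (En n × En n) → ℂ :=
  (Prod.fst ⁻¹' Ioo 0 T).indicator fun p => U p.1 p.2.1 p.2.2

theorem integral_integral_mul_eq_integral_slabExt {T : ℝ} {U : ℝ → En n → En n → ℂ}
    (hU : LocallyIntegrable (slabExt T U)) {b : ℝ × (En n × En n) → ℝ} (hb : Continuous b)
    (hc : HasCompactSupport b) :
    ∫ t in Ioo 0 T, ∫ q : En n × En n, U t q.1 q.2 * (b (t, q) : ℂ)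
      = ∫ p, b (kineticShear n p) • slabExt T U (kineticShear n p) := by
  rw [measurePreserving_kineticShear.integral_comp (kineticShear n).measurableEmbedding
    fun p => b p • slabExt T U p]
  have h := integral_prod _ (hU.integrable_smul_left_of_hasCompactSupport hb hc)
  rw [← Measure.volume_eq_prod] at h
  rw [h, ← integral_indicator measurableSet_Ioo]
  refine integral_congr_ae (Eventually.of_forall fun t => ?_)
  by_cases ht : t ∈ Ioo 0 T
  · simp only [indicator_of_mem ht, slabExt]
    refine integral_congr_ae (Eventually.of_forall fun q => ?_)
    have hm : (t, q) ∈ (Prod.fst ⁻¹' Ioo 0 T : Set (ℝ × (En n × En n))) := ht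
    simp only [indicator_of_mem hm, Complex.real_smul, mul_comm]
  · have hm (q : En n × En n) : (t, q) ∉ (Prod.fst ⁻¹' Ioo 0 T : Set (ℝ × (En n × En n))) := ht
    simp only [indicator_of_notMem ht, slabExt, indicator_of_notMem (hm _), smul_zero,
      integral_zero]

theorem fderiv_comp_kineticShear_symm {ψ : ℝ × (En n × En n) → ℝ} (hψ : ContDiff ℝ ∞ ψ)
    (t : ℝ) (q : En n × En n) {d : ℝ}
    (hd : HasDerivAt (fun s => ψ (s, q.1, q.2 + t • q.1)) d t) :
    fderiv ℝ (ψ ∘ (kineticShear n).symm) (t, q) ((1 : ℝ), ((0 : En n), -q.1)) = d := by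
  have hS : ContDiff ℝ ∞ (kineticShear n).symm := by
    change ContDiff ℝ ∞ fun p : ℝ × (En n × En n) => (p.1, p.2.1, p.2.2 + p.1 • p.2.1)
    fun_prop
  have hcurve : HasDerivAt (fun s : ℝ => (s, q.1, q.2 - (s - t) • q.1))
      ((1 : ℝ), ((0 : En n), -q.1)) t := by
    refine (hasDerivAt_id t).prodMk ((hasDerivAt_const t q.1).prodMk ?_)
    simpa using (((hasDerivAt_id t).sub_const t).smul_const q.1).const_sub q.2
  have hdiff : DifferentiableAt ℝ (ψ ∘ (kineticShear n).symm) (t, q.1, q.2 - (t - t) • q.1) :=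
    ((hψ.comp hS).differentiable (by simp)).differentiableAt
  have h := hdiff.hasFDerivAt.comp_hasDerivAt t hcurve
  have hc : (ψ ∘ (kineticShear n).symm) ∘ (fun s : ℝ => (s, q.1, q.2 - (s - t) • q.1))
      = fun s => ψ (s, q.1, q.2 + t • q.1) := by
    funext s
    simp only [Function.comp_apply, kineticShear_symm_apply]
    congr 3
    module
  rw [hc] at h
  simpa using h.unique hd

theorem IsFTransportDeriv.ae_shift_sub_eq {T : ℝ} {U H : ℝ → En n → En n → ℂ}
    (hTD : IsFTransportDeriv n T U H) (hU : LocallyIntegrable (slabExt T U))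
    (hH : LocallyIntegrable (slabExt T H)) {τ : En n → ℝ} (hτ : ContDiff ℝ ∞ τ)
    (hτ0 : ∀ k, 0 ≤ τ k) :
    ∀ᵐ p : ℝ × (En n × En n), 0 < p.1 ∧ p.1 + τ p.2.1 < T →
      slabExt T U (kineticShear n (p.1 + τ p.2.1, p.2)) - slabExt T U (kineticShear n p)
        = ∫ σ in Ioc 0 (τ p.2.1), slabExt T H (kineticShear n (p.1 + σ, p.2)) := by
  have hτ' : ContDiff ℝ ∞ fun q : En n × En n => τ q.1 := hτ.comp contDiff_fst
  have hτc := hτ'.continuous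
  have hΩ : IsOpen {p : ℝ × (En n × En n) | 0 < p.1 ∧ p.1 + τ p.2.1 < T} :=
    (isOpen_lt continuous_const continuous_fst).inter
      (isOpen_lt (continuous_fst.add (hτc.comp continuous_snd)) continuous_const)
  refine ae_shift_eq_of_forall_integral hτ' (fun q => hτ0 q.1)
    (LocallyIntegrable.comp_homeomorph hU _ measurePreserving_kineticShear)
    (LocallyIntegrable.comp_homeomorph hH _ measurePreserving_kineticShear) hΩ
    fun θ hθ hc hs => ?_
  set ψ := timeWindow (fun q : En n × En n => τ q.1) θ with hψ_def
  have hψ : ContDiff ℝ ∞ ψ := contDiff_timeWindow hτ' hθ hc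
  have hψc : HasCompactSupport ψ := hasCompactSupport_timeWindow hτc (fun q => hτ0 q.1) hc
  have hS : ContDiff ℝ ∞ (kineticShear n).symm := by
    change ContDiff ℝ ∞ fun p : ℝ × (En n × En n) => (p.1, p.2.1, p.2.2 + p.1 • p.2.1)
    fun_prop
  have hφc := hψc.comp_homeomorph (kineticShear n).symm
  have h := hTD (ψ ∘ (kineticShear n).symm) (hψ.comp hS) hφc fun p hp => by
    by_contra hne
    obtain ⟨σ, hσ, hσne⟩ := exists_ne_zero_of_timeWindow_ne_zero
      (τ := fun q : En n × En n => τ q.1) (p := (kineticShear n).symm p) (fun q => hτ0 q.1) hne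
    have hmem : 0 < p.1 - σ ∧ p.1 - σ + τ p.2.1 < T := hs (subset_tsupport _ hσne)
    have hστ : σ ≤ τ p.2.1 := hσ.2
    exact hp ⟨by linarith [hmem.1, hσ.1], by linarith [hmem.2, hστ]⟩
  set D : ℝ × (En n × En n) → ℝ := fun p => θ p - θ (p.1 - τ p.2.1, p.2) with hD_def
  have hDc : Continuous D := by
    have := hθ.continuous
    fun_prop
  have hDs : HasCompactSupport D :=
    hc.sub (hc.comp_homeomorph (timeShift (fun q : En n × En n => τ q.1) hτc).symm)
  have hfd (t : ℝ) (q : En n × En n) :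
      fderiv ℝ (ψ ∘ (kineticShear n).symm) (t, q) ((1 : ℝ), ((0 : En n), -q.1))
        = (D ∘ (kineticShear n).symm) (t, q) :=
    fderiv_comp_kineticShear_symm hψ t q (hasDerivAt_timeWindow hθ.continuous t _)
  simp only [hfd] at h
  rw [integral_integral_mul_eq_integral_slabExt hU
      (hDc.comp (kineticShear n).symm.continuous) (hDs.comp_homeomorph _),
    integral_integral_mul_eq_integral_slabExt hH
      (hψ.continuous.comp (kineticShear n).symm.continuous) hφc] at h
  simpa only [Function.comp_apply, Homeomorph.symm_apply_apply] using h

end kinetic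

section windowIntegral

variable {P : Type*} [TopologicalSpace P] [MeasureSpace P] [BorelSpace P]
  [SecondCountableTopology P] [SFinite (volume : Measure P)]

theorem lintegral_mul_setLIntegral_shift {τ : P → ℝ} (hτ : Continuous τ) {f : ℝ × P → ℝ≥0∞}
    (hf : Measurable f) {b : P → ℝ≥0∞} (hb : Measurable b) :
    ∫⁻ p : ℝ × P, b p.2 * ∫⁻ σ in Ioc 0 (τ p.2), f (p.1 + σ, p.2)
      = ∫⁻ p : ℝ × P, b p.2 * ENNReal.ofReal (τ p.2) * f p := by
  have hS : MeasurableSet {z : (ℝ × P) × ℝ | z.2 ∈ Ioc 0 (τ z.1.2)} := by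
    have := hτ.measurable
    exact (measurableSet_lt measurable_const measurable_snd).inter
      (measurableSet_le measurable_snd (by fun_prop))
  set F : (ℝ × P) × ℝ → ℝ≥0∞ :=
    {z : (ℝ × P) × ℝ | z.2 ∈ Ioc 0 (τ z.1.2)}.indicator fun z => b z.1.2 * f z.1 with hF_def
  have hF : Measurable F := Measurable.indicator (by fun_prop) hS
  have hshift := measurePreserving_timeShiftProd (P := P)
  calc _ = ∫⁻ p : ℝ × P, ∫⁻ σ : ℝ, F (timeShiftProd (p, σ)) := by
        refine lintegral_congr fun p => ?_
        rw [← lintegral_const_mul _ (by fun_prop), ← lintegral_indicator measurableSet_Ioc]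
        rfl
    _ = ∫⁻ z, F (timeShiftProd z) :=
        (lintegral_prod _ (hF.comp timeShiftProd.measurable).aemeasurable).symm
    _ = ∫⁻ z, F z := hshift.lintegral_comp hF
    _ = ∫⁻ p : ℝ × P, ∫⁻ σ : ℝ, F (p, σ) := by
        rw [Measure.volume_eq_prod (ℝ × P) ℝ, lintegral_prod _ hF.aemeasurable]
    _ = _ := by
        refine lintegral_congr fun p => ?_
        have h : (fun σ => F (p, σ)) = (Ioc 0 (τ p.2)).indicator fun _ => b p.2 * f p := rfl
        rw [h, lintegral_indicator measurableSet_Ioc, setLIntegral_const, Real.volume_Ioc, sub_zero]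
        ring

end windowIntegral

theorem sq_enorm_integral_Ioc_le {E : Type*} [NormedAddCommGroup E] [NormedSpace ℝ E] {g : ℝ → E}
    (hg : AEStronglyMeasurable g) (τ : ℝ) :
    ‖∫ σ in Ioc 0 τ, g σ‖ₑ ^ 2 ≤ ENNReal.ofReal τ * ∫⁻ σ in Ioc 0 τ, ‖g σ‖ₑ ^ 2 := by
  have h := ENNReal.lintegral_mul_le_Lp_mul_Lq (volume.restrict (Ioc 0 τ))
    Real.HolderConjugate.two_two (f := fun _ => (1 : ℝ≥0∞)) aemeasurable_const
    hg.restrict.enorm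
  calc _ ≤ (∫⁻ σ in Ioc 0 τ, ‖g σ‖ₑ) ^ 2 := by
        gcongr
        exact enorm_integral_le_lintegral_enorm _
    _ ≤ ((∫⁻ _ in Ioc 0 τ, (1 : ℝ≥0∞) ^ (2 : ℝ)) ^ (1 / 2 : ℝ)
          * (∫⁻ σ in Ioc 0 τ, ‖g σ‖ₑ ^ (2 : ℝ)) ^ (1 / 2 : ℝ)) ^ 2 := by
        gcongr
        simpa using h
    _ = _ := by
        rw [mul_pow, ← ENNReal.rpow_natCast, ← ENNReal.rpow_natCast, ← ENNReal.rpow_mul,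
          ← ENNReal.rpow_mul]
        norm_num

theorem LocallyIntegrable.of_setLIntegral_lt_top {X E : Type*} [TopologicalSpace X]
    [MeasurableSpace X] [NormedAddCommGroup E] [LocallyCompactSpace X] {μ : Measure X} {f : X → E}
    (hf : AEStronglyMeasurable f μ) (h : ∀ K, IsCompact K → ∫⁻ x in K, ‖f x‖ₑ ∂μ < ⊤) :
    LocallyIntegrable f μ :=
  locallyIntegrable_iff.2 fun K hK => ⟨hf.restrict, h K hK⟩

section slab

variable {n : ℕ}

theorem measurable_slabExt {U : ℝ → En n → En n → ℂ} (hU : MeasU n U) (T : ℝ) :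
    Measurable (slabExt T U) :=
  Measurable.indicator hU (measurable_fst measurableSet_Ioo)

theorem setLIntegral_eq_lintegral_slabExt {U : ℝ → En n → En n → ℂ} (hU : MeasU n U) (T : ℝ)
    {a : ℝ × (En n × En n) → ℝ} (ha : Measurable a) :
    ∫⁻ t in Ioo 0 T, ∫⁻ k, ∫⁻ ξ, ENNReal.ofReal (a (t, k, ξ) * ‖U t k ξ‖ ^ 2)
      = ∫⁻ p, ENNReal.ofReal (a p) * ‖slabExt T U p‖ₑ ^ 2 := by
  have hm := measurable_slabExt hU T
  have hf : Measurable fun p => ENNReal.ofReal (a p) * ‖slabExt T U p‖ₑ ^ 2 := by fun_prop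
  rw [Measure.volume_eq_prod, lintegral_prod _ hf.aemeasurable,
    ← lintegral_indicator measurableSet_Ioo]
  refine lintegral_congr fun t => ?_
  rw [Measure.volume_eq_prod, lintegral_prod _ (by fun_prop)]
  by_cases ht : t ∈ Ioo 0 T
  · rw [indicator_of_mem ht]
    refine lintegral_congr fun k => lintegral_congr fun ξ => ?_
    have hp : (t, k, ξ) ∈ (Prod.fst ⁻¹' Ioo 0 T : Set (ℝ × (En n × En n))) := ht
    rw [slabExt, indicator_of_mem hp, ENNReal.ofReal_mul' (by positivity),
      ENNReal.ofReal_pow (norm_nonneg _), ofReal_norm]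
  · have hp (q : En n × En n) : (t, q) ∉ (Prod.fst ⁻¹' Ioo 0 T : Set (ℝ × (En n × En n))) := ht
    simp [slabExt, indicator_of_notMem ht, indicator_of_notMem (hp _)]

theorem locallyIntegrable_slabExt {U : ℝ → En n → En n → ℂ} (hU : MeasU n U) {T κ : ℝ}
    (hκ : κ < 1)
    (h : ∫⁻ p : ℝ × (En n × En n), ENNReal.ofReal (p.1 ^ κ) * ‖slabExt T U p‖ₑ ^ 2 < ⊤) :
    LocallyIntegrable (slabExt T U) := by
  refine LocallyIntegrable.of_setLIntegral_lt_top
    (measurable_slabExt hU T).aestronglyMeasurable fun K hK => ?_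
  set g : ℝ → ℝ≥0∞ := (Ioo 0 T).indicator fun t => ENNReal.ofReal (t ^ (-κ)) with hg_def
  have hg : Measurable g := Measurable.indicator (by fun_prop) measurableSet_Ioo
  have hle (p : ℝ × (En n × En n)) :
      ‖slabExt T U p‖ₑ ≤ g p.1 + ENNReal.ofReal (p.1 ^ κ) * ‖slabExt T U p‖ₑ ^ 2 := by
    by_cases hp : p ∈ (Prod.fst ⁻¹' Ioo 0 T : Set (ℝ × (En n × En n)))
    · have hp' : p.1 ∈ Ioo 0 T := hp
      have hy : 0 < p.1 ^ κ := Real.rpow_pos_of_pos hp'.1 _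
      rw [hg_def, indicator_of_mem hp', Real.rpow_neg hp'.1.le, ← ofReal_norm,
        ← ENNReal.ofReal_pow (norm_nonneg _), ← ENNReal.ofReal_mul hy.le,
        ← ENNReal.ofReal_add (by positivity) (by positivity)]
      refine ENNReal.ofReal_le_ofReal ?_
      have h2 : (p.1 ^ κ)⁻¹ * (p.1 ^ κ * ‖slabExt T U p‖ - 1) ^ 2 + ‖slabExt T U p‖
          = (p.1 ^ κ)⁻¹ + p.1 ^ κ * ‖slabExt T U p‖ ^ 2 - ‖slabExt T U p‖ := by
        field_simp
        ring
      have h3 : 0 ≤ (p.1 ^ κ)⁻¹ * (p.1 ^ κ * ‖slabExt T U p‖ - 1) ^ 2 := by positivity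
      linarith [norm_nonneg (slabExt T U p)]
    · simp [slabExt, indicator_of_notMem hp]
  have hgfin : ∫⁻ t, g t < ⊤ := by
    rw [hg_def, lintegral_indicator measurableSet_Ioo]
    rcases le_or_gt T 0 with hT | hT
    · simp [Ioo_eq_empty_of_le hT]
    have := (intervalIntegral.intervalIntegrable_rpow' (a := 0) (b := T) (r := -κ)
      (by linarith)).1.mono_set Ioo_subset_Ioc_self
    exact (lintegral_mono fun t => Real.ofReal_le_enorm _).trans_lt this.2
  set S := Prod.snd '' K with hS_def
  have hS : IsCompact S := hK.image continuous_snd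
  calc _ ≤ ∫⁻ p in K, (g p.1 + ENNReal.ofReal (p.1 ^ κ) * ‖slabExt T U p‖ₑ ^ 2) :=
        lintegral_mono hle
    _ = (∫⁻ p in K, g p.1) + ∫⁻ p in K, ENNReal.ofReal (p.1 ^ κ) * ‖slabExt T U p‖ₑ ^ 2 :=
        lintegral_add_left (by fun_prop) _
    _ ≤ (∫⁻ t, g t) * volume S
          + ∫⁻ p, ENNReal.ofReal (p.1 ^ κ) * ‖slabExt T U p‖ₑ ^ 2 := by
        gcongr
        · calc _ ≤ ∫⁻ p in univ ×ˢ S, g p.1 :=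
                lintegral_mono_set fun p hp => ⟨trivial, mem_image_of_mem _ hp⟩
            _ = _ := by
                rw [Measure.volume_eq_prod, setLIntegral_prod _ (by fun_prop)]
                simp only [lintegral_const, Measure.restrict_apply_univ, Measure.restrict_univ]
                rw [lintegral_mul_const _ hg]
        · exact Measure.restrict_le_self
    _ < ⊤ := ENNReal.add_lt_top.2 ⟨ENNReal.mul_lt_top hgfin hS.measure_lt_top, h⟩

end slab

/-- The length of the time window used at spatial frequency `k`: a smooth function comparable to
`(1 + ‖k‖) ^ (-r / (r + 1))`. -/
def windowLength (n : ℕ) (c r : ℝ) (k : En n) : ℝ := c * (1 + ‖k‖ ^ 2) ^ (-(r / (2 * (r + 1))))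

section windowLength

open scoped ContDiff

variable {n : ℕ} {c r : ℝ}

theorem contDiff_windowLength : ContDiff ℝ ∞ (windowLength n c r) := by
  refine contDiff_const.mul (ContDiff.rpow_const_of_ne ?_ fun k => by positivity)
  exact contDiff_const.add (contDiff_norm_sq ℝ)

theorem windowLength_nonneg (hc : 0 ≤ c) (k : En n) : 0 ≤ windowLength n c r k := by
  unfold windowLength
  positivity

theorem windowLength_le (hc : 0 ≤ c) (hr : 0 ≤ r) (k : En n) : windowLength n c r k ≤ c :=
  mul_le_of_le_one_right hc <| Real.rpow_le_one_of_one_le_of_nonpos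
    (by linarith [sq_nonneg ‖k‖]) (by rw [neg_nonpos]; positivity)

theorem windowLength_sq (k : En n) :
    windowLength n c r k ^ 2 = c ^ 2 * (1 + ‖k‖ ^ 2) ^ (-(r / (r + 1))) := by
  rw [windowLength, mul_pow, ← Real.rpow_natCast ((1 + ‖k‖ ^ 2) ^ _) 2,
    ← Real.rpow_mul (by positivity)]
  congr 2
  rw [← div_div, div_right_comm]
  push_cast
  ring

theorem rpow_mul_windowLength_sq (k : En n) :
    (1 + ‖k‖ ^ 2) ^ (r / (r + 1)) * windowLength n c r k ^ 2 = c ^ 2 := by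
  rw [windowLength_sq, mul_left_comm, ← Real.rpow_add (by positivity), add_neg_cancel,
    Real.rpow_zero, mul_one]

theorem rpow_le_mul_rpow_of_windowLength_le (hc : 0 < c) (hr : 0 ≤ r) (k : En n) {y : ℝ}
    (h : windowLength n c r k * ‖k‖ / 2 ≤ y) :
    (1 + ‖k‖ ^ 2) ^ (r / (r + 1)) ≤ max 1 (4 / c ^ 2) ^ r * (1 + y ^ 2) ^ r := by
  have hb : 1 ≤ 1 + ‖k‖ ^ 2 := by linarith [sq_nonneg ‖k‖]
  set a := (1 + ‖k‖ ^ 2) ^ (1 / (r + 1)) with ha_def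
  have ha : 1 ≤ a := Real.one_le_rpow hb (by positivity)
  have har : a ^ r = (1 + ‖k‖ ^ 2) ^ (r / (r + 1)) := by
    rw [ha_def, ← Real.rpow_mul (by positivity)]
    congr 1
    ring
  have har1 : a ^ r * a = 1 + ‖k‖ ^ 2 := by
    rw [har, ha_def, ← Real.rpow_add (by positivity), ← add_div, div_self (by positivity),
      Real.rpow_one]
  have har0 : 1 ≤ a ^ r := Real.one_le_rpow ha hr
  have hsq := rpow_mul_windowLength_sq (c := c) (r := r) k
  rw [← har] at hsq ⊢
  have h4 : windowLength n c r k ^ 2 * ‖k‖ ^ 2 ≤ 4 * y ^ 2 := by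
    have h0 : 0 ≤ windowLength n c r k * ‖k‖ / 2 := by
      have := windowLength_nonneg (r := r) hc.le k
      positivity
    have := pow_le_pow_left₀ h0 h 2
    linarith [this, div_pow (windowLength n c r k * ‖k‖) 2 2,
      mul_pow (windowLength n c r k) ‖k‖ 2]
  have h5 : c ^ 2 * (a - 1) ≤ 4 * y ^ 2 := by
    have e : a ^ r * (windowLength n c r k ^ 2 * ‖k‖ ^ 2) = c ^ 2 * (a ^ r * a - 1) := by
      rw [har1, ← mul_assoc, hsq]
      ring
    have h6 : a ^ r * (c ^ 2 * (a - 1)) ≤ a ^ r * (4 * y ^ 2) := by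
      have h7 : a ^ r * (c ^ 2 * (a - 1)) ≤ c ^ 2 * (a ^ r * a - 1) := by
        nlinarith [mul_nonneg (sq_nonneg c) (sub_nonneg.2 har0)]
      have h8 := mul_le_mul_of_nonneg_left h4 (zero_le_one.trans har0)
      linarith
    exact le_of_mul_le_mul_left h6 (by linarith)
  have h6 : a ≤ max 1 (4 / c ^ 2) * (1 + y ^ 2) := by
    have h7 : a - 1 ≤ 4 / c ^ 2 * y ^ 2 := by
      rw [div_mul_eq_mul_div, le_div_iff₀ (by positivity)]
      linarith
    nlinarith [le_max_left 1 (4 / c ^ 2),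
      mul_le_mul_of_nonneg_right (le_max_right 1 (4 / c ^ 2)) (sq_nonneg y)]
  rw [← Real.mul_rpow (by positivity) (by positivity)]
  exact Real.rpow_le_rpow (by positivity) h6 hr

end windowLength

theorem rpow_le_four_mul_rpow {s t κ : ℝ} (ht : 0 < t) (hts : t ≤ 4 * s) (hκ0 : 0 ≤ κ)
    (hκ1 : κ ≤ 1) : t ^ κ ≤ 4 * s ^ κ := by
  have hs : 0 < s := by linarith
  calc t ^ κ ≤ (4 * s) ^ κ := Real.rpow_le_rpow ht.le hts hκ0
    _ = 4 ^ κ * s ^ κ := Real.mul_rpow (by norm_num) hs.le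
    _ ≤ 4 ^ (1 : ℝ) * s ^ κ := by
        gcongr
        norm_num
    _ = _ := by rw [Real.rpow_one]

theorem sq_enorm_le_of_sq_enorm_sub_le {E : Type*} [NormedAddCommGroup E] {u v : E} {D : ℝ≥0∞}
    (h : ‖u - v‖ₑ ^ 2 ≤ D) : ‖u‖ₑ ^ 2 ≤ 2 * (‖v‖ₑ ^ 2 + D) := by
  have h1 : ‖u‖ₑ ≤ ‖v‖ₑ + ‖u - v‖ₑ := by
    simpa using enorm_add_le v (u - v)
  have h2 := ENNReal.rpow_add_le_mul_rpow_add_rpow ‖v‖ₑ ‖u - v‖ₑ (p := 2) (by norm_num)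
  norm_num at h2
  calc _ ≤ (‖v‖ₑ + ‖u - v‖ₑ) ^ 2 := by gcongr
    _ ≤ 2 * (‖v‖ₑ ^ 2 + ‖u - v‖ₑ ^ 2) := h2
    _ ≤ _ := by gcongr

theorem mul_sq_enorm_le_of_sq_enorm_sub_le {E : Type*} [NormedAddCommGroup E] {u v : E}
    {D a b m x y M : ℝ≥0∞} (h : ‖u - v‖ₑ ^ 2 ≤ D) (hab : a ≤ 4 * b)
    (hm : m ≤ M * x ∨ m ≤ M * y) :
    a * m * ‖u‖ₑ ^ 2
      ≤ M * (a * x * ‖u‖ₑ ^ 2) + 8 * M * (b * y * ‖v‖ₑ ^ 2) + 2 * (a * m * D) := by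
  rcases hm with hm | hm
  · calc _ ≤ a * (M * x) * ‖u‖ₑ ^ 2 := by gcongr
      _ = M * (a * x * ‖u‖ₑ ^ 2) := by ring
      _ ≤ _ := by
        rw [add_assoc]
        exact le_self_add
  · calc _ ≤ a * m * (2 * (‖v‖ₑ ^ 2 + D)) := by
          gcongr
          exact sq_enorm_le_of_sq_enorm_sub_le h
      _ = 2 * (a * m * ‖v‖ₑ ^ 2) + 2 * (a * m * D) := by ring
      _ ≤ 2 * (4 * b * (M * y) * ‖v‖ₑ ^ 2) + 2 * (a * m * D) := by gcongr
      _ = 8 * M * (b * y * ‖v‖ₑ ^ 2) + 2 * (a * m * D) := by ring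
      _ ≤ _ := by
        rw [add_assoc (M * _)]
        exact le_add_self

section estimate

variable {n : ℕ}

/-- The weighted squared modulus `t ^ κ * w(k, ξ) * |U(t, k, ξ)|²` on the slab `0 < t < T`. -/
def slabDensity (T κ : ℝ) (w : En n × En n → ℝ) (U : ℝ → En n → En n → ℂ)
    (p : ℝ × (En n × En n)) : ℝ≥0∞ :=
  ENNReal.ofReal (p.1 ^ κ) * ENNReal.ofReal (w p.2) * ‖slabExt T U p‖ₑ ^ 2

/-- The contribution of the transport derivative to the estimate along a characteristic. -/
def windowDensity (T κ : ℝ) (m τ : En n → ℝ) (H : ℝ → En n → En n → ℂ)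
    (p : ℝ × (En n × En n)) : ℝ≥0∞ :=
  ENNReal.ofReal (m p.2.1) * ENNReal.ofReal (τ p.2.1) * ∫⁻ σ in Ioc 0 (τ p.2.1),
    slabDensity T κ (fun _ => 1) H (kineticShear n (p.1 + σ, p.2))

theorem measurable_slabDensity {T κ : ℝ} {w : En n × En n → ℝ} (hw : Measurable w)
    {U : ℝ → En n → En n → ℂ} (hU : MeasU n U) : Measurable (slabDensity T κ w U) := by
  have := measurable_slabExt hU T
  unfold slabDensity
  fun_prop

theorem setLIntegral_eq_lintegral_slabDensity {U : ℝ → En n → En n → ℂ} (hU : MeasU n U)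
    (T κ : ℝ) {w : En n × En n → ℝ} (hw : Measurable w) (hw0 : ∀ q, 0 ≤ w q) :
    ∫⁻ t in Ioo 0 T, ∫⁻ k, ∫⁻ ξ, ENNReal.ofReal (t ^ κ * w (k, ξ) * ‖U t k ξ‖ ^ 2)
      = ∫⁻ p, slabDensity T κ w U p := by
  rw [setLIntegral_eq_lintegral_slabExt hU T (a := fun p => p.1 ^ κ * w p.2) (by fun_prop)]
  simp only [slabDensity, ENNReal.ofReal_mul' (hw0 _)]

theorem lintegral_windowDensity {T κ : ℝ} {m τ : En n → ℝ} (hm : Measurable m)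
    (hτ : Continuous τ) {C : ℝ} (hmτ : ∀ k, m k * τ k ^ 2 = C) (hm0 : ∀ k, 0 ≤ m k)
    (hτ0 : ∀ k, 0 ≤ τ k) {H : ℝ → En n → En n → ℂ} (hH : MeasU n H) :
    ∫⁻ p, windowDensity T κ m τ H p
      = ENNReal.ofReal C * ∫⁻ p, slabDensity T κ (fun _ => 1) H p := by
  have hB := measurable_slabDensity (T := T) (κ := κ) (w := fun _ => 1) measurable_const hH
  have hBS := hB.comp (kineticShear n).measurable
  have hτm := hτ.measurable
  have h := lintegral_mul_setLIntegral_shift (P := En n × En n) (τ := fun q => τ q.1)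
    (by fun_prop) hBS
    (b := fun q => ENNReal.ofReal (m q.1) * ENNReal.ofReal (τ q.1)) (by fun_prop)
  refine h.trans ?_
  rw [← measurePreserving_kineticShear.lintegral_comp hB]
  refine (lintegral_congr fun p => ?_).trans (lintegral_const_mul _ hBS)
  rw [← hmτ p.2.1, mul_assoc (ENNReal.ofReal _), ← ENNReal.ofReal_mul (hτ0 _),
    ← ENNReal.ofReal_mul (hm0 _), sq]
  rfl

theorem ofReal_rpow_mul_window_le {T κ : ℝ} (hκ0 : 0 ≤ κ) (hκ1 : κ ≤ 1) (m τ : En n → ℝ)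
    (H : ℝ → En n → En n → ℂ) {s : ℝ} (hs : 0 < s) {p : ℝ × (En n × En n)} (hsp : s ≤ 4 * p.1) :
    ENNReal.ofReal (s ^ κ) * ENNReal.ofReal (m p.2.1) * (ENNReal.ofReal (τ p.2.1) *
        ∫⁻ σ in Ioc 0 (τ p.2.1), ‖slabExt T H (kineticShear n (p.1 + σ, p.2))‖ₑ ^ 2)
      ≤ 4 * windowDensity T κ m τ H p := by
  calc _ = ENNReal.ofReal (m p.2.1) * ENNReal.ofReal (τ p.2.1) * (ENNReal.ofReal (s ^ κ) *
        ∫⁻ σ in Ioc 0 (τ p.2.1), ‖slabExt T H (kineticShear n (p.1 + σ, p.2))‖ₑ ^ 2) := by ring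
    _ ≤ ENNReal.ofReal (m p.2.1) * ENNReal.ofReal (τ p.2.1) * (4 * ∫⁻ σ in Ioc 0 (τ p.2.1),
          slabDensity T κ (fun _ => 1) H (kineticShear n (p.1 + σ, p.2))) := by
        gcongr ENNReal.ofReal (m p.2.1) * ENNReal.ofReal (τ p.2.1) * ?_
        rw [← lintegral_const_mul' _ _ ENNReal.ofReal_ne_top,
          ← lintegral_const_mul' _ _ (by norm_num)]
        refine setLIntegral_mono' measurableSet_Ioc fun σ hσ => ?_
        have h := rpow_le_four_mul_rpow hs (s := p.1 + σ) (by linarith [hσ.1]) hκ0 hκ1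
        have h' := ENNReal.ofReal_le_ofReal h
        rw [ENNReal.ofReal_mul (by norm_num), ENNReal.ofReal_ofNat] at h'
        simp only [slabDensity, kineticShear_apply, ENNReal.ofReal_one, mul_one]
        rw [← mul_assoc]
        gcongr
    _ = _ := by
        rw [windowDensity]
        ring

theorem IsFTransportDeriv.ae_slabDensity_le {T κ r c : ℝ} {U H : ℝ → En n → En n → ℂ}
    (hTD : IsFTransportDeriv n T U H) (hU : LocallyIntegrable (slabExt T U))
    (hH : LocallyIntegrable (slabExt T H)) (hHm : MeasU n H) (hκ0 : 0 ≤ κ) (hκ1 : κ ≤ 1)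
    (hr : 0 ≤ r) (hc : 0 < c) {M : ℝ≥0∞}
    (hM : M = ENNReal.ofReal (max 1 (4 / c ^ 2) ^ r))
    {Φ F W : ℝ × (En n × En n) → ℝ≥0∞}
    (hΦ : Φ = slabDensity T κ (fun q => (1 + ‖q.1‖ ^ 2) ^ (r / (r + 1))) U)
    (hF : F = slabDensity T κ (fun q => (1 + ‖q.2‖ ^ 2) ^ r) U)
    (hW : W = windowDensity T κ (fun k => (1 + ‖k‖ ^ 2) ^ (r / (r + 1))) (windowLength n c r) H) :
    ∀ᵐ p : ℝ × (En n × En n), ∀ p', p' = (p.1 + windowLength n c r p.2.1, p.2) →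
      0 < p.1 → p'.1 < T →
      Φ (kineticShear n p)
          ≤ M * F (kineticShear n p) + 8 * M * F (kineticShear n p') + 8 * W p ∧
      (p'.1 ≤ 4 * p.1 → Φ (kineticShear n p')
          ≤ M * F (kineticShear n p') + 8 * M * F (kineticShear n p) + 8 * W p) := by
  filter_upwards [hTD.ae_shift_sub_eq hU hH contDiff_windowLength
    (windowLength_nonneg (r := r) hc.le)] with p hp p' hp' hp0 hpT
  have hτ0 := windowLength_nonneg (r := r) hc.le p.2.1
  subst hp'
  have hHs := measurable_slabExt hHm T
  have hS := (kineticShear n).measurable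
  have hD := sq_enorm_integral_Ioc_le
    (g := fun σ => slabExt T H (kineticShear n (p.1 + σ, p.2)))
    (Measurable.aestronglyMeasurable (by fun_prop)) (windowLength n c r p.2.1)
  rw [← hp ⟨hp0, hpT⟩] at hD
  have hx : windowLength n c r p.2.1 * ‖p.2.1‖ / 2 ≤ ‖p.2.2 - p.1 • p.2.1‖ ∨
      windowLength n c r p.2.1 * ‖p.2.1‖ / 2
        ≤ ‖p.2.2 - (p.1 + windowLength n c r p.2.1) • p.2.1‖ := by
    by_contra! hcon
    have h := norm_sub_le (p.2.2 - p.1 • p.2.1)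
      (p.2.2 - (p.1 + windowLength n c r p.2.1) • p.2.1)
    have e : p.2.2 - p.1 • p.2.1 - (p.2.2 - (p.1 + windowLength n c r p.2.1) • p.2.1)
        = windowLength n c r p.2.1 • p.2.1 := by module
    rw [e, norm_smul, Real.norm_of_nonneg hτ0] at h
    linarith [hcon.1, hcon.2]
  have hm {y : ℝ} (hy : windowLength n c r p.2.1 * ‖p.2.1‖ / 2 ≤ y) :
      ENNReal.ofReal ((1 + ‖p.2.1‖ ^ 2) ^ (r / (r + 1)))
        ≤ M * ENNReal.ofReal ((1 + y ^ 2) ^ r) := by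
    rw [hM, ← ENNReal.ofReal_mul (by positivity)]
    exact ENNReal.ofReal_le_ofReal (rpow_le_mul_rpow_of_windowLength_le hc hr _ hy)
  have hx' := hx.imp hm hm
  have hw {s t : ℝ} (ht : 0 < t) (hts : t ≤ 4 * s) :
      ENNReal.ofReal (t ^ κ) ≤ 4 * ENNReal.ofReal (s ^ κ) := by
    rw [← ENNReal.ofReal_ofNat 4, ← ENNReal.ofReal_mul (by norm_num)]
    exact ENNReal.ofReal_le_ofReal (rpow_le_four_mul_rpow ht hts hκ0 hκ1)
  have h24 (a : ℝ≥0∞) : 2 * (4 * a) = 8 * a := by ring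
  have hwin {s : ℝ} (hs : 0 < s) (hsp : s ≤ 4 * p.1) :=
    (mul_le_mul' le_rfl (ofReal_rpow_mul_window_le (T := T) hκ0 hκ1
      (fun k => (1 + ‖k‖ ^ 2) ^ (r / (r + 1))) (windowLength n c r) H hs hsp)).trans_eq (h24 _)
  have hp1 : 0 < p.1 + windowLength n c r p.2.1 := by linarith
  have hp14 : p.1 ≤ 4 * (p.1 + windowLength n c r p.2.1) := by linarith
  subst hΦ hF hW
  refine ⟨?_, fun h4 => ?_⟩
  · exact (mul_sq_enorm_le_of_sq_enorm_sub_le ((congrArg (· ^ 2)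
      (enorm_sub_rev _ _)).trans_le hD) (hw hp0 hp14) hx').trans
        (add_le_add le_rfl (hwin hp0 (by linarith)))
  · exact (mul_sq_enorm_le_of_sq_enorm_sub_le hD (hw hp1 h4) hx'.symm).trans
      (add_le_add le_rfl (hwin hp1 h4))

theorem measurable_windowDensity {T κ : ℝ} {m τ : En n → ℝ} (hm : Measurable m)
    (hτ : Measurable τ) {H : ℝ → En n → En n → ℂ} (hH : MeasU n H) :
    Measurable (windowDensity T κ m τ H) := by
  have hB := measurable_slabDensity (T := T) (κ := κ) (w := fun _ => 1) measurable_const hH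
  have hS := (kineticShear n).measurable
  have hE : MeasurableSet {z : (ℝ × (En n × En n)) × ℝ | z.2 ∈ Ioc 0 (τ z.1.2.1)} :=
    (measurableSet_lt measurable_const measurable_snd).inter
      (measurableSet_le measurable_snd (by fun_prop))
  have hF : Measurable ({z : (ℝ × (En n × En n)) × ℝ | z.2 ∈ Ioc 0 (τ z.1.2.1)}.indicator
      fun z => slabDensity T κ (fun _ => 1) H (kineticShear n (z.1.1 + z.2, z.1.2))) :=
    Measurable.indicator (by fun_prop) hE
  refine Measurable.mul (by fun_prop) ?_
  simp only [← lintegral_indicator measurableSet_Ioc]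
  exact hF.lintegral_prod_right' (ν := volume)

theorem IsFTransportDeriv.lintegral_slabDensity_lt_top {T κ r : ℝ} {U H : ℝ → En n → En n → ℂ}
    (hTD : IsFTransportDeriv n T U H) (hT : 0 < T) (hUm : MeasU n U) (hHm : MeasU n H)
    (hU : LocallyIntegrable (slabExt T U)) (hH : LocallyIntegrable (slabExt T H))
    (hκ0 : 0 ≤ κ) (hκ1 : κ ≤ 1) (hr : 0 ≤ r)
    (hF : ∫⁻ p, slabDensity T κ (fun q => (1 + ‖q.2‖ ^ 2) ^ r) U p < ⊤)
    (hB : ∫⁻ p, slabDensity T κ (fun _ => 1) H p < ⊤) :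
    ∫⁻ p, slabDensity T κ (fun q => (1 + ‖q.1‖ ^ 2) ^ (r / (r + 1))) U p < ⊤ := by
  obtain ⟨c, hc⟩ : ∃ c, c = T / 4 := ⟨_, rfl⟩
  have hc0 : 0 < c := by linarith
  obtain ⟨M, hM⟩ : ∃ M, M = ENNReal.ofReal (max 1 (4 / c ^ 2) ^ r) := ⟨_, rfl⟩
  obtain ⟨Φ, hΦ⟩ : ∃ Φ, Φ = slabDensity T κ (fun q : En n × En n =>
    (1 + ‖q.1‖ ^ 2) ^ (r / (r + 1))) U := ⟨_, rfl⟩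
  obtain ⟨F, hF'⟩ : ∃ F, F = slabDensity T κ (fun q : En n × En n => (1 + ‖q.2‖ ^ 2) ^ r) U :=
    ⟨_, rfl⟩
  obtain ⟨W, hW⟩ : ∃ W, W = windowDensity T κ (fun k : En n => (1 + ‖k‖ ^ 2) ^ (r / (r + 1)))
    (windowLength n c r) H := ⟨_, rfl⟩
  have hτ : Continuous (windowLength n c r) := contDiff_windowLength.continuous
  have hτ0 := windowLength_nonneg (n := n) (r := r) hc0.le
  have hτc := windowLength_le (n := n) hc0.le hr
  have hτq : Continuous fun q : En n × En n => windowLength n c r q.1 := hτ.comp continuous_fst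
  have hFm : Measurable F := hF' ▸ measurable_slabDensity (by fun_prop) hUm
  have hΦm : Measurable Φ := hΦ ▸ measurable_slabDensity (by fun_prop) hUm
  have hWm : Measurable W := hW ▸ measurable_windowDensity (by fun_prop) hτ.measurable hHm
  have hWfin : ∫⁻ p, W p < ⊤ := by
    rw [hW, lintegral_windowDensity (by fun_prop) hτ rpow_mul_windowLength_sq
      (fun k => by positivity) hτ0 hHm]
    exact ENNReal.mul_lt_top ENNReal.ofReal_lt_top hB
  have hS := measurePreserving_kineticShear (n := n)
  set P := timeShift _ hτq with hP_def
  have hP : MeasurePreserving P := measurePreserving_timeShift _ hτq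
  have hP' : MeasurePreserving P.symm := hP.symm P.toMeasurableEquiv
  have hae := hTD.ae_slabDensity_le hU hH hHm hκ0 hκ1 hr hc0 hM hΦ hF' hW
  have hle : ∀ᵐ p, Φ (kineticShear n p) ≤
      M * F (kineticShear n p) + (8 * M * F (kineticShear n (P p)) + 8 * W p)
        + (8 * M * F (kineticShear n (P.symm p)) + 8 * W (P.symm p)) := by
    filter_upwards [hae, hP'.quasiMeasurePreserving.ae hae] with p hp hp'
    by_cases ht : p.1 ∈ Ioo 0 T
    · have h1 := hτc p.2.1
      have h2 : (P.symm p).1 = p.1 - windowLength n c r p.2.1 := rfl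
      rcases lt_or_ge p.1 (T / 2) with hlt | hge
      · refine ((hp (P p) rfl ht.1 ?_).1).trans ?_
        · change p.1 + windowLength n c r p.2.1 < T
          linarith
        · rw [add_assoc (M * _)]
          exact le_self_add
      · refine ((hp' p (P.apply_symm_apply p).symm (by linarith) ht.2).2 (by linarith)).trans ?_
        rw [add_assoc (M * _)]
        exact add_le_add le_self_add le_rfl
    · have h0 : kineticShear n p ∉ (Prod.fst ⁻¹' Ioo 0 T : Set (ℝ × (En n × En n))) := ht
      simp [hΦ, slabDensity, slabExt, indicator_of_notMem h0]
  rw [← hΦ, ← hS.lintegral_comp hΦm]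
  have hFS := hFm.comp (kineticShear n).measurable
  have e1 : ∫⁻ p, F (kineticShear n p) = ∫⁻ p, F p := hS.lintegral_comp hFm
  have e2 : ∫⁻ p, F (kineticShear n (P p)) = ∫⁻ p, F p := (hP.lintegral_comp hFS).trans e1
  have e3 : ∫⁻ p, F (kineticShear n (P.symm p)) = ∫⁻ p, F p := (hP'.lintegral_comp hFS).trans e1
  have e4 : ∫⁻ p, W (P.symm p) = ∫⁻ p, W p := hP'.lintegral_comp hWm
  rw [← hF'] at hF
  refine (lintegral_mono_ae hle).trans_lt ?_
  have hPm := P.measurable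
  have hPm' := P.symm.measurable
  have hSm := (kineticShear n).measurable
  have hM' : M < ⊤ := hM ▸ ENNReal.ofReal_lt_top
  rw [lintegral_add_left (by fun_prop), lintegral_add_left (by fun_prop),
    lintegral_add_left (by fun_prop), lintegral_add_left (by fun_prop),
    lintegral_const_mul _ (by fun_prop), lintegral_const_mul _ (by fun_prop),
    lintegral_const_mul _ (by fun_prop), lintegral_const_mul _ (by fun_prop),
    lintegral_const_mul _ (by fun_prop), e1, e2, e3, e4]
  finiteness

end estimate

theorem stmt19 (n : ℕ) (hn : 1 ≤ n) (T μ r : ℝ) (hT : 0 < T)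
    (hμ : μ ∈ Ioc (1/2 : ℝ) 1) (hr : 0 ≤ r)
    (U H : ℝ → En n → En n → ℂ) (hU : MeasU n U) (hH : MeasU n H)
    -- `∂_t u + v·∇ₓ u ∈ L²_μ((0,T);L²(ℝ^{2n}))`
    (hTD : IsFTransportDeriv n T U H)
    -- `u ∈ L²_μ((0,T);L²(ℝ^{2n}))`
    (hU2 : (∫⁻ t in Ioo (0:ℝ) T, ∫⁻ (k : En n), ∫⁻ (ξ : En n),
        ENNReal.ofReal (t ^ (2 - 2*μ) * ‖U t k ξ‖ ^ 2)) < ⊤)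
    (hH2 : (∫⁻ t in Ioo (0:ℝ) T, ∫⁻ (k : En n), ∫⁻ (ξ : En n),
        ENNReal.ofReal (t ^ (2 - 2*μ) * ‖H t k ξ‖ ^ 2)) < ⊤)
    -- `u ∈ L²_μ((0,T);H_v^r(ℝ^{2n}))`
    (hHv : (∫⁻ t in Ioo (0:ℝ) T, ∫⁻ (k : En n), ∫⁻ (ξ : En n),
        ENNReal.ofReal (t ^ (2 - 2*μ) * (1 + ‖ξ‖ ^ 2) ^ r * ‖U t k ξ‖ ^ 2)) < ⊤) :
    -- then `u ∈ L²_μ((0,T);H_x^{r/(r+1)}(ℝ^{2n}))`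
    (∫⁻ t in Ioo (0:ℝ) T, ∫⁻ (k : En n), ∫⁻ (ξ : En n),
        ENNReal.ofReal (t ^ (2 - 2*μ) * (1 + ‖k‖ ^ 2) ^ (r / (r + 1)) * ‖U t k ξ‖ ^ 2)) < ⊤ := by
  have hκ0 : 0 ≤ 2 - 2 * μ := by linarith [hμ.2]
  have hκ1 : 2 - 2 * μ < 1 := by linarith [hμ.1]
  rw [setLIntegral_eq_lintegral_slabExt hU T (a := fun p => p.1 ^ (2 - 2 * μ)) (by fun_prop)]
    at hU2
  rw [setLIntegral_eq_lintegral_slabExt hH T (a := fun p => p.1 ^ (2 - 2 * μ)) (by fun_prop)]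
    at hH2
  rw [setLIntegral_eq_lintegral_slabDensity hU T (2 - 2 * μ)
    (w := fun q => (1 + ‖q.2‖ ^ 2) ^ r) (by fun_prop) (fun q => by positivity)] at hHv
  rw [setLIntegral_eq_lintegral_slabDensity hU T (2 - 2 * μ)
    (w := fun q => (1 + ‖q.1‖ ^ 2) ^ (r / (r + 1))) (by fun_prop) (fun q => by positivity)]
  refine hTD.lintegral_slabDensity_lt_top hT hU hH (locallyIntegrable_slabExt hU hκ1 hU2)
    (locallyIntegrable_slabExt hH hκ1 hH2) hκ0 hκ1.le hr hHv ?_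
  simpa [slabDensity] using hH2
end
end
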